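/- Let p, q be positive integers. For every integer c with 1 ≤ c ≤ min{p,q}, the number of partitions in NC^B(p,q) with connectivity equal to c is exactly 2c · C(2p, p-c) · C(2q, q-c). -/

import Mathlib

/-!  Common setup: annular non-crossing partitions of type B, following
Goulden–Nica–Oancea, "Enumerative properties of NC^(B)(p,q)". -/

/-- The underlying set `{±1, …, ±n}`, realized inside `ℤ`. -/
def signedSet (n : ℕ) : Set ℤ := {x : ℤ | x ≠ 0 ∧ |x| ≤ (n : ℤ)}

/-- Membership in the hyperoctahedral group `B_n`, realized as the permutations of `ℤ`
that commute with negation and fix every point outside `{±1, …, ±n}`. -/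
def inB (n : ℕ) (π : Equiv.Perm ℤ) : Prop :=
  (∀ x : ℤ, π (-x) = -(π x)) ∧ ∀ x : ℤ, x ∉ signedSet n → π x = x

/-- The set of generators of `B_n`:
`(i,j)(-i,-j)`, `(i,-j)(-i,j)` for `1 ≤ i ≠ j ≤ n`, and `(i,-i)` for `1 ≤ i ≤ n`. -/
def genB (n : ℕ) : Set (Equiv.Perm ℤ) :=
  {π | (∃ i j : ℤ, 1 ≤ i ∧ i ≤ (n : ℤ) ∧ 1 ≤ j ∧ j ≤ (n : ℤ) ∧ i ≠ j ∧
          π = Equiv.swap i j * Equiv.swap (-i) (-j)) ∨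
       (∃ i j : ℤ, 1 ≤ i ∧ i ≤ (n : ℤ) ∧ 1 ≤ j ∧ j ≤ (n : ℤ) ∧ i ≠ j ∧
          π = Equiv.swap i (-j) * Equiv.swap (-i) j) ∨
       (∃ i : ℤ, 1 ≤ i ∧ i ≤ (n : ℤ) ∧ π = Equiv.swap i (-i))}

/-- The length function `ℓ_B` on `B_n`: the least `k` such that `τ` is a product of `k`
generators from `genB n` (the empty product being the identity). -/
noncomputable def lenB (n : ℕ) (τ : Equiv.Perm ℤ) : ℕ :=
  sInf {k : ℕ | ∃ l : List (Equiv.Perm ℤ),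
    l.length = k ∧ (∀ g ∈ l, g ∈ genB n) ∧ l.prod = τ}

/-- The partial order on `B_n`:  `τ ≤ σ` iff `ℓ_B(σ) = ℓ_B(τ) + ℓ_B(τ⁻¹σ)`. -/
def leB (n : ℕ) (τ σ : Equiv.Perm ℤ) : Prop :=
  lenB n σ = lenB n τ + lenB n (τ⁻¹ * σ)

/-- The permutation `γ_{p,q} = (1,…,p,-1,…,-p)(p+1,…,p+q,-(p+1),…,-(p+q))`. -/
def gammaPQ (p q : ℕ) : Equiv.Perm ℤ :=
  (((List.range p).map fun i => ((i : ℤ) + 1)) ++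
      ((List.range p).map fun i => -((i : ℤ) + 1))).formPerm *
    (((List.range q).map fun i => ((p : ℤ) + (i : ℤ) + 1)) ++
      ((List.range q).map fun i => -((p : ℤ) + (i : ℤ) + 1))).formPerm

/-- The long cycle `γ_n = (1,…,n,-1,…,-n)` of `B_n` (disc case). -/
def gammaDisc (n : ℕ) : Equiv.Perm ℤ :=
  (((List.range n).map fun i => ((i : ℤ) + 1)) ++
    ((List.range n).map fun i => -((i : ℤ) + 1))).formPerm

/-- The annular non-crossing permutations of type B: `S^B_nc(p,q) = [ε, γ_{p,q}] ⊆ B_{p+q}`. -/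
def SncB (p q : ℕ) : Set (Equiv.Perm ℤ) :=
  {τ | inB (p + q) τ ∧ leB (p + q) τ (gammaPQ p q)}

/-- The orbit of `x` under the permutation `τ`. -/
def permOrbit (τ : Equiv.Perm ℤ) (x : ℤ) : Set ℤ := {y | ∃ m : ℤ, (τ ^ m) x = y}

/-- The partition `Ω(τ)` of `{±1,…,±n}` into orbits of `τ`. -/
def orbitsOn (n : ℕ) (τ : Equiv.Perm ℤ) : Set (Set ℤ) :=
  {A | ∃ x ∈ signedSet n, A = permOrbit τ x}

/-- The negation `-A` of a set `A ⊆ ℤ`. -/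
def negSet (A : Set ℤ) : Set ℤ := {x | -x ∈ A}

/-- The partition `Ω̃(τ)`, obtained from `Ω(τ)` by merging all inversion-invariant orbits
(orbits `A` with `A = -A`) into a single block. -/
def omegaTilde (n : ℕ) (τ : Equiv.Perm ℤ) : Set (Set ℤ) :=
  {A | A ∈ orbitsOn n τ ∧ negSet A ≠ A} ∪
    {B | B = ⋃₀ {A | A ∈ orbitsOn n τ ∧ negSet A = A} ∧ B.Nonempty}

/-- The annular non-crossing partitions of type B: `NC^B(p,q) = {Ω̃(τ) : τ ∈ S^B_nc(p,q)}`. -/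
def NCB (p q : ℕ) : Set (Set (Set ℤ)) :=
  {π | ∃ τ ∈ SncB p q, π = omegaTilde (p + q) τ}

/-- The type B non-crossing partitions of the disc: `NC^B(n) = {Ω̃(τ) : τ ∈ B_n, τ ≤ γ_n}`. -/
def NCBdisc (n : ℕ) : Set (Set (Set ℤ)) :=
  {π | ∃ τ, inB n τ ∧ leB n τ (gammaDisc n) ∧ π = omegaTilde n τ}

/-- Reverse refinement order on partitions: every block of `π` is contained in a block of `ρ`. -/
def refines (π ρ : Set (Set ℤ)) : Prop := ∀ A ∈ π, ∃ B ∈ ρ, A ⊆ B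

/-- The rank of a partition of `{±1,…,±n}`:
`n` minus half the number of blocks `A` with `A ≠ -A`. -/
noncomputable def rankNCB (n : ℕ) (π : Set (Set ℤ)) : ℕ :=
  n - {A | A ∈ π ∧ negSet A ≠ A}.ncard / 2

/-- The inner point set `{±(p+1), …, ±(p+q)}`. -/
def innerSet (p q : ℕ) : Set ℤ := {x : ℤ | (p : ℤ) < |x| ∧ |x| ≤ (p : ℤ) + (q : ℤ)}

/-- The connectivity of `π ∈ NC^B(p,q)`: half the number of blocks `A` with `A ≠ -A`
meeting both `{±1,…,±p}` and `{±(p+1),…,±(p+q)}`. -/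
noncomputable def connectivity (p q : ℕ) (π : Set (Set ℤ)) : ℕ :=
  {A | A ∈ π ∧ negSet A ≠ A ∧ (A ∩ signedSet p).Nonempty ∧
    (A ∩ innerSet p q).Nonempty}.ncard / 2

/-- The number of exterior pairs of blocks `{A, -A}` (with `A ≠ -A`, `A ⊆ {±1,…,±p}`). -/
noncomputable def extPairs (p : ℕ) (π : Set (Set ℤ)) : ℕ :=
  {A | A ∈ π ∧ negSet A ≠ A ∧ A ⊆ signedSet p}.ncard / 2

/-- The number of interior pairs of blocks `{A, -A}`
(with `A ≠ -A`, `A ⊆ {±(p+1),…,±(p+q)}`). -/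
noncomputable def intPairs (p q : ℕ) (π : Set (Set ℤ)) : ℕ :=
  {A | A ∈ π ∧ negSet A ≠ A ∧ A ⊆ innerSet p q}.ncard / 2

/-- The minimum `0̂` of `NC^B(p,q)` (with `n = p+q`): the partition into singletons. -/
def botNCB (n : ℕ) : Set (Set ℤ) := {A | ∃ x ∈ signedSet n, A = {x}}

/-- The maximum `1̂` of `NC^B(p,q)` (with `n = p+q`): the partition with a single block. -/
def topNCB (n : ℕ) : Set (Set ℤ) := {signedSet n}

/-- The orbit of `x` under the subgroup generated by `{τ, γ}`. -/
def jointOrbit (τ γ : Equiv.Perm ℤ) (x : ℤ) : Set ℤ :=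
  {y | ∃ g ∈ Subgroup.closure ({τ, γ} : Set (Equiv.Perm ℤ)), g x = y}

/-- The orbits on `{±1,…,±n}` of the subgroup generated by `{τ, γ}`. -/
def jointOrbitsOn (n : ℕ) (τ γ : Equiv.Perm ℤ) : Set (Set ℤ) :=
  {Y | ∃ x ∈ signedSet n, Y = jointOrbit τ γ x}


namespace NCBProof

def Arc (H : ℤ → ℤ) (a b : ℤ) : Prop :=
  a < b ∧ H (b + 1) = H a ∧ ∀ t, a < t → t ≤ b → H a < H t

def Th (H : ℤ → ℤ) (a : ℤ) : Prop := ∀ t, a < t → H a < H t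

structure Word (r c : ℤ) (H : ℤ → ℤ) : Prop where
  rpos : 0 < r
  cpos : 0 < c
  step : ∀ t, H (t + 1) = H t + 1 ∨ H (t + 1) = H t - 1
  per : ∀ t, H (t + 2 * r) = H t + 2 * c
  zero : H 0 = 0

namespace Word
variable {r c : ℤ} {H : ℤ → ℤ}

lemma per_mul (h : Word r c H) (m t : ℤ) : H (t + 2 * r * m) = H t + 2 * c * m := by
  induction m using Int.induction_on with
  | zero => simp
  | succ i ih =>
    have := h.per (t + 2 * r * i)
    rw [show t + 2 * r * ((i : ℤ) + 1) = t + 2 * r * i + 2 * r by ring, this, ih]; ring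
  | pred i ih =>
    have := h.per (t + 2 * r * (-(i:ℤ) - 1))
    rw [show t + 2 * r * (-(i : ℤ) - 1) + 2 * r = t + 2 * r * (-(i:ℤ)) by ring, ih] at this
    linarith

lemma par (h : Word r c H) (t : ℤ) : Even (H t - t) := by
  induction t using Int.induction_on with
  | zero => simp [h.zero]
  | succ i ih => rcases h.step i with e | e <;> rw [e] <;> grind
  | pred i ih =>
    have := h.step (-(i:ℤ) - 1)
    rw [show -(i:ℤ) - 1 + 1 = -i by ring] at this
    rcases this with e | e <;> grind

lemma arc_odd (h : Word r c H) {a b : ℤ} (hab : Arc H a b) : Odd (a + b) := by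
  have h1 := h.par a
  have h2 := h.par (b + 1)
  rw [hab.2.1] at h2
  grind

lemma arc_shift (h : Word r c H) {a b : ℤ} (hab : Arc H a b) (m : ℤ) :
    Arc H (a + 2 * r * m) (b + 2 * r * m) := by
  obtain ⟨h1, h2, h3⟩ := hab
  refine ⟨by linarith, ?_, ?_⟩
  · rw [show b + 2 * r * m + 1 = (b + 1) + 2 * r * m by ring, h.per_mul, h.per_mul, h2]
  · intro t ht ht'
    have := h3 (t - 2 * r * m) (by linarith) (by linarith)
    have e := h.per_mul m (t - 2 * r * m)
    rw [sub_add_cancel] at e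
    rw [e, h.per_mul]; linarith

lemma th_shift (h : Word r c H) {a : ℤ} (ha : Th H a) (m : ℤ) : Th H (a + 2 * r * m) := by
  intro t ht
  have := ha (t - 2 * r * m) (by linarith)
  have e := h.per_mul m (t - 2 * r * m)
  rw [sub_add_cancel] at e
  rw [e, h.per_mul]; linarith

end Word

lemma Arc.right_unique {H : ℤ → ℤ} {a b b' : ℤ} (h : Arc H a b) (h' : Arc H a b') : b = b' := by
  obtain ⟨h1, h2, h3⟩ := h
  obtain ⟨h1', h2', h3'⟩ := h'
  rcases lt_trichotomy b b' with hl | hl | hl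
  · have := h3' (b + 1) (by omega) (by omega); omega
  · exact hl
  · have := h3 (b' + 1) (by omega) (by omega); omega

lemma Arc.left_unique {H : ℤ → ℤ} {a a' b : ℤ} (h : Arc H a b) (h' : Arc H a' b) : a = a' := by
  obtain ⟨h1, h2, h3⟩ := h
  obtain ⟨h1', h2', h3'⟩ := h'
  rcases lt_trichotomy a a' with hl | hl | hl
  · have := h3 a' (by omega) (by omega); omega
  · exact hl
  · have := h3' a (by omega) (by omega); omega

lemma Arc.not_th_left {H : ℤ → ℤ} {a b : ℤ} (h : Arc H a b) : ¬ Th H a := by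
  intro ht
  have := ht (b + 1) (by have := h.1; omega)
  rw [h.2.1] at this; omega

lemma Arc.not_th_right {H : ℤ → ℤ} {a b : ℤ} (h : Arc H a b) : ¬ Th H b := by
  intro ht
  have := ht (b + 1) (by omega)
  have h3 := h.2.2 b h.1 le_rfl
  rw [h.2.1] at this; omega

lemma Arc.not_arc {H : ℤ → ℤ} {a b d : ℤ} (h : Arc H a b) (h' : Arc H b d) : False := by
  have h3 := h.2.2 b h.1 le_rfl
  have := h.2.1
  have h4 := h'.2.2 (b + 1) (by omega) (by have := h'.1; omega)
  omega

/-- nesting -/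
lemma Arc.nest1 {H : ℤ → ℤ} {lo hi a b : ℤ} (h : Arc H lo hi) (h' : Arc H a b) :
    (lo < a ∧ a ≤ hi) ↔ (lo < b + 1 ∧ b + 1 ≤ hi) := by
  obtain ⟨h1, h2, h3⟩ := h
  obtain ⟨h1', h2', h3'⟩ := h'
  constructor
  · rintro ⟨x, y⟩
    refine ⟨by omega, ?_⟩
    by_contra hc
    have e1 := h3 a x y
    rcases eq_or_lt_of_le (show hi + 1 ≤ b + 1 by omega) with e | e
    · rw [← e] at h2'; omega
    · have := h3' (hi + 1) (by omega) (by omega); omega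
  · rintro ⟨x, y⟩
    refine ⟨?_, by omega⟩
    by_contra hc
    have e1 := h3 (b + 1) x y
    rcases eq_or_lt_of_le (show a ≤ lo by omega) with e | e
    · rw [e] at h2'; omega
    · have := h3' lo (by omega) (by omega); omega

lemma Arc.nest2 {H : ℤ → ℤ} {lo hi a b : ℤ} (h : Arc H lo hi) (h' : Arc H a b) :
    (lo < a + 1 ∧ a + 1 ≤ hi) ↔ (lo < b ∧ b ≤ hi) := by
  have n1 := h.nest1 h'
  rcases eq_or_ne a lo with e | e
  · subst e
    have := h.right_unique h'
    have := h.1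
    omega
  · have e2 : b ≠ hi := by
      rintro rfl; exact e (h'.left_unique h)
    have := h.1
    have := h'.1
    have : a = hi → False := by
      rintro rfl; exact h.not_arc h'
    have : b = lo → False := by
      rintro rfl; exact h'.not_arc h
    omega

lemma Th.not_in {H : ℤ → ℤ} {lo hi a : ℤ} (h : Arc H lo hi) (h' : Th H a) :
    ¬ (lo < a ∧ a ≤ hi) := by
  rintro ⟨x, y⟩
  have := h.2.2 a x y
  have := h' (hi + 1) (by omega)
  have := h.2.1
  omega

lemma Th.not_in' {H : ℤ → ℤ} {lo hi a : ℤ} (h : Arc H lo hi) (h' : Th H a) :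
    ¬ (lo < a + 1 ∧ a + 1 ≤ hi) := by
  rintro ⟨x, y⟩
  have n := Th.not_in h h'
  have : a = lo := by omega
  subst this
  exact h.not_th_left h'

lemma Th.sep1 {H : ℤ → ℤ} {s a b : ℤ} (h : Arc H a b) (h' : Th H s) : s < a ↔ s < b + 1 := by
  have n := Th.not_in h h'
  have := h.1
  have : s ≠ a := by rintro rfl; exact h.not_th_left h'
  omega

lemma Th.sep2 {H : ℤ → ℤ} {s a b : ℤ} (h : Arc H a b) (h' : Th H s) : s < a + 1 ↔ s < b := by
  have n := Th.not_in h h'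
  have := h.1
  have : s ≠ a := by rintro rfl; exact h.not_th_left h'
  omega

lemma Th.lt_iff {H : ℤ → ℤ} {a b : ℤ} (h : Th H a) (h' : Th H b) : a < b ↔ H a < H b := by
  constructor
  · exact h b
  · intro hl
    by_contra hc
    rcases eq_or_lt_of_le (not_lt.mp hc) with e | e
    · subst e; omega
    · have := h' a e; omega

lemma Th.le_iff {H : ℤ → ℤ} {a b : ℤ} (h : Th H a) (h' : Th H b) : a ≤ b ↔ H a ≤ H b := by
  have := Th.lt_iff h' h
  omega

lemma Th.inj {H : ℤ → ℤ} {a b : ℤ} (h : Th H a) (h' : Th H b) (e : H a = H b) : a = b := by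
  have := Th.lt_iff h' h
  have := Th.lt_iff h h'
  omega

namespace Word
variable {r c : ℤ} {H : ℤ → ℤ}

lemma arc_lt (h : Word r c H) {a b : ℤ} (hab : Arc H a b) : b < a + 2 * r := by
  by_contra hc
  have h1 := h.arc_shift hab 1
  have := hab.nest1 h1
  have := h.rpos
  omega

lemma exists_left (h : Word r c H) {t : ℤ} (ht : H (t + 1) = H t - 1) : ∃ a, Arc H a t := by
  obtain ⟨a, ⟨ha1, ha2⟩, ha3⟩ := Int.exists_greatest_of_bdd
    (P := fun z => z < t ∧ H z ≤ H (t + 1)) ⟨t, fun z hz => hz.1.le⟩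
    ⟨t + 2 * r * (-1), by have := h.rpos; linarith, by
      rw [h.per_mul]; have := h.cpos; omega⟩
  refine ⟨a, ha1, ?_, ?_⟩
  · rcases eq_or_lt_of_le (show a + 1 ≤ t by omega) with e | e
    · have := h.step a; rw [e] at this; omega
    · have : ¬ (H (a + 1) ≤ H (t + 1)) := fun hh => by have := ha3 _ ⟨e, hh⟩; omega
      have := h.step a; omega
  · intro s hs hs'
    rcases eq_or_lt_of_le hs' with e | e
    · subst e; omega
    · have : ¬ (H s ≤ H (t + 1)) := fun hh => by have := ha3 _ ⟨e, hh⟩; omega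
      omega

lemma exists_right (h : Word r c H) {t : ℤ} (ht : H (t + 1) = H t + 1) (hn : ¬ Th H t) :
    ∃ b, Arc H t b := by
  simp only [Th, not_forall, not_lt] at hn
  obtain ⟨s0, hs0, hs0'⟩ := hn
  obtain ⟨s, ⟨hs1, hs2⟩, hs3⟩ := Int.exists_least_of_bdd
    (P := fun z => t < z ∧ H z ≤ H t) ⟨t, fun z hz => hz.1.le⟩ ⟨s0, hs0, hs0'⟩
  have hne : s ≠ t + 1 := by rintro rfl; omega
  have hh : ∀ z, t < z → z ≤ s - 1 → H t < H z := by
    intro z hz hz'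
    by_contra hc
    have := hs3 z ⟨hz, by omega⟩
    omega
  refine ⟨s - 1, by omega, ?_, hh⟩
  have := hh (s - 1) (by omega) le_rfl
  have h4 := h.step (s - 1)
  rw [sub_add_cancel] at h4 ⊢
  omega

lemma trichotomy (h : Word r c H) (t : ℤ) : Th H t ∨ (∃ b, Arc H t b) ∨ ∃ a, Arc H a t := by
  rcases h.step t with e | e
  · by_cases ht : Th H t
    · exact Or.inl ht
    · exact Or.inr (Or.inl (h.exists_right e ht))
  · exact Or.inr (Or.inr (h.exists_left e))

lemma abs_bd (h : Word r c H) (t : ℕ) : |H t| ≤ t := by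
  induction t with
  | zero => simp [h.zero]
  | succ i ih =>
    push_cast
    rw [abs_le] at ih ⊢
    rcases h.step i with e | e <;> constructor <;> omega

lemma lower (h : Word r c H) (t : ℤ) : -(2 * r) + 2 * c * (t / (2 * r)) ≤ H t := by
  have hr := h.rpos
  have e := Int.emod_add_mul_ediv t (2 * r)
  have h1 := Int.emod_nonneg t (show (2 * r) ≠ 0 by omega)
  have h2 := Int.emod_lt_of_pos t (show 0 < 2 * r by omega)
  have h3 := h.per_mul (t / (2 * r)) (t % (2 * r))
  rw [e] at h3
  have h4 := h.abs_bd (t % (2 * r)).toNat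
  rw [Int.toNat_of_nonneg h1, abs_le'] at h4
  rw [h3]
  omega

lemma exists_level (h : Word r c H) (l : ℤ) : ∃ a, Th H a ∧ H a = l := by
  have hr := h.rpos
  have hc := h.cpos
  obtain ⟨a, ha1, ha2⟩ := Int.exists_greatest_of_bdd (P := fun z => H z ≤ l)
    ⟨2 * r * (|l| + 2 * r + 1), by
      intro z hz
      have h1 := h.lower z
      have h2 : z / (2 * r) < |l| + 2 * r + 1 := by
        by_contra hcon
        have := le_abs_self l
        have := abs_nonneg l
        nlinarith
      exact (Int.lt_mul_of_ediv_lt (by omega) h2).le.trans (le_of_eq (by ring))⟩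
    ⟨0 + 2 * r * (-|l|), by
      rw [h.per_mul, h.zero]
      have := neg_abs_le l
      have := abs_nonneg l
      nlinarith⟩
  have hgt : ∀ t, a < t → l < H t := by
    intro t ht
    by_contra hcon
    have := ha2 t (by omega)
    omega
  have h1 := hgt (a + 1) (by omega)
  have h2 := h.step a
  have : H a = l := by omega
  exact ⟨a, fun t ht => by rw [this]; exact hgt t ht, this⟩

end Word
end NCBProof

namespace NCBProof

structure Mat (r : Bool → ℤ) (J : Bool → ℤ → Bool → ℤ → Prop) : Prop where
  rpos : ∀ b, 0 < r b
  symm : ∀ {b s b' s'}, J b s b' s' → J b' s' b s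
  total : ∀ b s, ∃ b' s', J b s b' s'
  func : ∀ {b s b1 s1 b2 s2}, J b s b1 s1 → J b s b2 s2 → b1 = b2 ∧ ∃ m, s2 = s1 + 4 * r b1 * m
  shift : ∀ {b s b' s'}, J b s b' s' → ∀ m, J b s b' (s' + 4 * r b' * m)
  neg : ∀ {b s b' s'}, J b s b' s' → J b (s + 2 * r b) b' (s' + 2 * r b')
  par : ∀ {b s b' s'}, J b s b' s' → Odd (s + s')

structure IsPot (r : Bool → ℤ) (J : Bool → ℤ → Bool → ℤ → Prop) (b0 : Bool) (s0 : ℤ)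
    (P : Bool → ℤ → ℚ) : Prop where
  anti : ∀ b t, P b (t + 2 * r b) = - P b t
  swap : ∀ {b s b' s'}, J b s b' s' → P b s = P b' (s' + 1)
  jump1 : P b0 (s0 + 1) - P b0 s0 = 1
  jump0 : ∀ b s, Even s → ¬ (b = b0 ∧ ∃ m, s = s0 + 2 * r b0 * m) → P b (s + 1) = P b s

def Planar (r : Bool → ℤ) (J : Bool → ℤ → Bool → ℤ → Prop) : Prop :=
  ∀ b0 s0, Even s0 → ∃ P, IsPot r J b0 s0 P

namespace Mat
variable {r : Bool → ℤ} {J : Bool → ℤ → Bool → ℤ → Prop}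

lemma neg_mul (h : Mat r J) {b s b' s'} (hj : J b s b' s') (m : ℤ) :
    J b (s + 2 * r b * m) b' (s' + 2 * r b' * m) := by
  have key : ∀ {s s'}, J b s b' s' → J b (s - 2 * r b) b' (s' - 2 * r b') := by
    intro s s' hj
    have h1 := h.neg hj
    have h2 := h.shift h1 (-1)
    have h3 := h.shift (h.symm h2) (-1)
    have := h.symm h3
    convert this using 1 <;> ring
  induction m using Int.induction_on with
  | zero => simpa using hj
  | succ i ih => convert h.neg ih using 1 <;> ring
  | pred i ih => convert key ih using 1 <;> ring

lemma pot_pair (h : Mat r J) (hp : Planar r J) {b s b' s'} (hj : J b s b' s') :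
    ∃ P : Bool → ℤ → ℚ, (∀ b t, P b (t + 2 * r b) = - P b t) ∧
      (∀ {b s b' s'}, J b s b' s' → P b s = P b' (s' + 1)) ∧
      P b (s + 1) - P b s = 1 ∧
      ∀ b1 s1, ¬ (b1 = b ∧ ∃ m, s1 = s + 2 * r b * m) →
        ¬ (b1 = b' ∧ ∃ m, s1 = s' + 2 * r b' * m) → P b1 (s1 + 1) = P b1 s1 := by
  have key : ∀ {b s b' s'}, J b s b' s' → Even s →
    ∃ P : Bool → ℤ → ℚ, (∀ b t, P b (t + 2 * r b) = - P b t) ∧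
      (∀ {b s b' s'}, J b s b' s' → P b s = P b' (s' + 1)) ∧
      P b (s + 1) - P b s = 1 ∧ P b' (s' + 1) - P b' s' = -1 ∧
      ∀ b1 s1, ¬ (b1 = b ∧ ∃ m, s1 = s + 2 * r b * m) →
        ¬ (b1 = b' ∧ ∃ m, s1 = s' + 2 * r b' * m) → P b1 (s1 + 1) = P b1 s1 := by
    intro b s b' s' hj he
    obtain ⟨P, hP⟩ := hp b s he
    refine ⟨P, hP.anti, hP.swap, hP.jump1, ?_, ?_⟩
    · have h1 := hP.swap hj
      have h2 := hP.swap (h.symm hj)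
      have h3 := hP.jump1
      linarith
    · intro b1 s1 n1 n2
      rcases Int.even_or_odd s1 with e | e
      · exact hP.jump0 b1 s1 e n1
      · obtain ⟨b2, s2, hj2⟩ := h.total b1 s1
        have hodd := h.par hj2
        have e2 : Even s2 := by grind
        have h1 := hP.swap hj2
        have h2 := hP.swap (h.symm hj2)
        rw [h1, ← h2]
        symm
        apply hP.jump0 b2 s2 e2
        rintro ⟨rfl, m, rfl⟩
        apply n2
        have h3 := h.neg_mul hj m
        obtain ⟨hb, m', hm'⟩ := h.func h3 (h.symm hj2)
        refine ⟨hb.symm, m + 2 * m', ?_⟩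
        rw [hm']; ring
  rcases Int.even_or_odd s with e | e
  · obtain ⟨P, h1, h2, h3, h4, h5⟩ := key hj e
    exact ⟨P, h1, h2, h3, h5⟩
  · have hodd := h.par hj
    obtain ⟨P, h1, h2, h3, h4, h5⟩ := key (h.symm hj) (by grind)
    refine ⟨fun b t => - P b t, ?_, ?_, ?_, ?_⟩
    · intro b t; beta_reduce; rw [h1]
    · intro b s b' s' hj; beta_reduce; rw [h2 hj]
    · simp only; linarith
    · intro b1 s1 n1 n2; simp only; rw [h5 b1 s1 n2 n1]

lemma const_on {P : ℤ → ℚ} {x y : ℤ} (h : ∀ t, x < t → t < y → P (t + 1) = P t) :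
    ∀ t, x < t → t ≤ y → P t = P (x + 1) := by
  intro t ht
  induction t, (show x + 1 ≤ t by omega) using Int.leInduction with
  | base => intro _; rfl
  | succ n hn ih => 
    intro h2
    rw [h n (by omega) (by omega), ih (by omega) (by omega)]

/-- two integers in classes mod 2r -/
lemma no_mult {r m x : ℤ} (_hr : 0 < r) (h1 : 0 < x) (h2 : x < 2 * r) (h : x = 2 * r * m) :
    False := by
  rcases le_or_gt m 0 with hm | hm <;> nlinarith

/-- reduce into window -/
lemma window {r : ℤ} (hr : 0 < r) (x y : ℤ) : ∃ m, x < y + 4 * r * m ∧ y + 4 * r * m ≤ x + 4 * r := by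
  refine ⟨-((y - x - 1) / (4 * r)), ?_⟩
  have h1 := Int.emod_add_mul_ediv (y - x - 1) (4 * r)
  have h2 := Int.emod_nonneg (y - x - 1) (show 4 * r ≠ 0 by omega)
  have h3 := Int.emod_lt_of_pos (y - x - 1) (show 0 < 4 * r by omega)
  have : 4 * r * -((y - x - 1) / (4 * r)) = - (4 * r * ((y - x - 1) / (4 * r))) := by ring
  constructor <;> linarith

lemma anti_mul {P : Bool → ℤ → ℚ} (ha : ∀ b t, P b (t + 2 * r b) = - P b t) (b : Bool) (t m : ℤ) :
    P b (t + 4 * r b * m) = P b t := by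
  have step : ∀ t, P b (t + 4 * r b) = P b t := by
    intro t
    have h1 := ha b t
    have h2 := ha b (t + 2 * r b)
    rw [h1, neg_neg] at h2
    rw [← h2]; congr 1; ring
  induction m using Int.induction_on with
  | zero => simp
  | succ i ih => rw [← ih, ← step (t + 4 * r b * i)]; congr 1; ring
  | pred i ih => rw [← ih, ← step (t + 4 * r b * (-(i:ℤ) - 1))]; congr 1; ring

lemma closed (h : Mat r J) (hp : Planar r J) {b lo hi} (hj : J b lo b hi) (h1 : lo < hi)
    (h2 : hi < lo + 2 * r b) {s b' s'} (hs1 : lo < s) (hs2 : s < hi) (hjs : J b s b' s') :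
    b' = b ∧ ∃ m, lo < s' + 4 * r b * m ∧ s' + 4 * r b * m < hi := by
  obtain ⟨P, ha, hsw, hj1, hj0⟩ := h.pot_pair hp hj
  have hr := h.rpos b
  have z1 : ∀ t, lo < t → t < hi → P b (t + 1) = P b t := by
    intro t t1 t2
    apply hj0
    · rintro ⟨-, m, hm⟩
      exact no_mult (m := m) hr (x := t - lo) (by omega) (by omega) (by linarith)
    · rintro ⟨-, m, hm⟩
      exact no_mult (m := -m) hr (x := hi - t) (by omega) (by omega) (by linarith)
  have z2 : ∀ t, hi < t → t < lo + 2 * r b → P b (t + 1) = P b t := by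
    intro t t1 t2
    apply hj0
    · rintro ⟨-, m, hm⟩
      exact no_mult (m := m) hr (x := t - lo) (by omega) (by omega) (by linarith)
    · rintro ⟨-, m, hm⟩
      exact no_mult (m := m) hr (x := t - hi) (by omega) (by omega) (by linarith)
  have c1 := const_on z1
  have c2 := const_on z2
  have d1 := hsw hj
  have d2 := hsw (h.symm hj)
  have a1 := ha b lo
  have e0 := c2 (lo + 2 * r b) h2 le_rfl
  have v0 : P b (hi + 1) = 0 := by rw [a1] at e0; linarith
  have v1 : P b (lo + 1) = 1 := by linarith
  have other : ∀ t, P (!b) t = 0 := by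
    have hc : ∀ t, P (!b) (t + 1) = P (!b) t := by
      intro t
      apply hj0 <;> (rintro ⟨e, -⟩; simp at e)
    intro t
    have hr' := h.rpos (!b)
    have := const_on (x := t - 1) (y := t + 2 * r (!b)) (fun t _ _ => hc t)
      (t + 2 * r (!b)) (by omega) le_rfl
    rw [sub_add_cancel, ha] at this
    linarith
  have w1 : ∀ t, lo < t → t ≤ lo + 4 * r b → P b t = 1 → t ≤ hi := by
    intro t t1 t2 hP
    by_contra hc
    by_cases t3 : t ≤ lo + 2 * r b
    · have := c2 t (by omega) t3; rw [this, v0] at hP; norm_num at hP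
    · have e := ha b (t - 2 * r b)
      rw [sub_add_cancel] at e
      by_cases t4 : t - 2 * r b ≤ hi
      · have := c1 (t - 2 * r b) (by omega) t4; rw [e, this, v1] at hP; norm_num at hP
      · have := c2 (t - 2 * r b) (by omega) (by omega); rw [e, this, v0] at hP; norm_num at hP
  have g1 := hsw hjs
  have g2 := hsw (h.symm hjs)
  rw [c1 s hs1 hs2.le, v1] at g1
  rw [c1 (s + 1) (by omega) (by omega), v1] at g2
  have hb : b' = b := by
    by_contra hne
    have : b' = !b := by revert hne; cases b <;> cases b' <;> simp
    subst this
    rw [other] at g2; norm_num at g2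
  subst hb
  refine ⟨rfl, ?_⟩
  obtain ⟨m, m1, m2⟩ := window hr lo s'
  have q1 : P b' (s' + 4 * r b' * m) = 1 := by rw [anti_mul ha]; exact g2
  have q2 : P b' (s' + 4 * r b' * m + 1) = 1 := by
    rw [show s' + 4 * r b' * m + 1 = (s' + 1) + 4 * r b' * m by ring, anti_mul ha]; exact g1.symm
  refine ⟨m, m1, ?_⟩
  have l1 := w1 _ m1 m2 q1
  rcases eq_or_lt_of_le l1 with e | e
  · rw [e, v0] at q2; norm_num at q2
  · exact e

lemma through (h : Mat r J) (hp : Planar r J) {b s s'} (hj : J b s (!b) s')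
    {a a'} (ha1 : s < a) (ha2 : a < s + 2 * r b) (hja : J b a (!b) a') :
    ∃ m, s' - 2 * r (!b) < a' + 4 * r (!b) * m ∧ a' + 4 * r (!b) * m < s' := by
  obtain ⟨P, ha, hsw, hj1, hj0⟩ := h.pot_pair hp hj
  have hr := h.rpos b
  have hr' := h.rpos (!b)
  have z1 : ∀ t, s < t → t < s + 2 * r b → P b (t + 1) = P b t := by
    intro t t1 t2
    apply hj0
    · rintro ⟨-, m, hm⟩
      exact no_mult (m := m) hr (x := t - s) (by omega) (by omega) (by linarith)
    · rintro ⟨e, -⟩; simp at e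
  have z2 : ∀ t, s' < t → t < s' + 2 * r (!b) → P (!b) (t + 1) = P (!b) t := by
    intro t t1 t2
    apply hj0
    · rintro ⟨e, -⟩; simp at e
    · rintro ⟨-, m, hm⟩
      exact no_mult (m := m) hr' (x := t - s') (by omega) (by omega) (by linarith)
  have c1 := const_on z1
  have c2 := const_on z2
  have d1 := hsw hj
  have d2 := hsw (h.symm hj)
  have e1 := c1 (s + 2 * r b) (by omega) le_rfl
  rw [ha] at e1
  have v1 : P b (s + 1) = 1 / 2 := by linarith
  have v2 : P (!b) (s' + 1) = -(1 / 2) := by linarith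
  have g1 := hsw hja
  have g2 := hsw (h.symm hja)
  rw [c1 a (by omega) (by omega), v1] at g1
  rw [c1 (a + 1) (by omega) (by omega), v1] at g2
  obtain ⟨m, m1, m2⟩ := window hr' (s' - 2 * r (!b)) a'
  have q1 : P (!b) (a' + 4 * r (!b) * m) = 1 / 2 := by rw [anti_mul ha]; exact g2
  have q2 : P (!b) (a' + 4 * r (!b) * m + 1) = 1 / 2 := by
    rw [show a' + 4 * r (!b) * m + 1 = (a' + 1) + 4 * r (!b) * m by ring, anti_mul ha]
    exact g1.symm
  refine ⟨m, m1, ?_⟩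
  by_contra hc
  rcases eq_or_lt_of_le (not_lt.mp hc) with e | e
  · rw [← e, v2] at q2; norm_num at q2
  · have := c2 _ e (by omega)
    rw [this, v2] at q1; norm_num at q1

end Mat
end NCBProof

namespace NCBProof

noncomputable def Hgt (w : ℤ → ℤ) (t : ℤ) : ℤ := ∑ i ∈ Finset.Ico 0 t, w i - ∑ i ∈ Finset.Ico t 0, w i

lemma Hgt_succ (w : ℤ → ℤ) (t : ℤ) : Hgt w (t + 1) = Hgt w t + w t := by
  unfold Hgt
  rcases le_or_gt 0 t with h | h
  · rw [Finset.Ico_eq_empty (by omega : ¬ t < 0), Finset.Ico_eq_empty (by omega : ¬ t + 1 < 0)]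
    have : Finset.Ico 0 (t + 1) = insert t (Finset.Ico 0 t) := by
      ext x; simp; omega
    rw [this, Finset.sum_insert (by simp)]; simp; ring
  · rw [Finset.Ico_eq_empty (by omega : ¬ 0 < t), Finset.Ico_eq_empty (by omega : ¬ 0 < t + 1)]
    have : Finset.Ico t 0 = insert t (Finset.Ico (t + 1) 0) := by
      ext x; simp; omega
    rw [this, Finset.sum_insert (by simp)]; simp

lemma Hgt_zero (w : ℤ → ℤ) : Hgt w 0 = 0 := by simp [Hgt]

lemma Hgt_sub (w : ℤ → ℤ) {a t : ℤ} (h : a ≤ t) :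
    Hgt w t = Hgt w a + ∑ i ∈ Finset.Ico a t, w i := by
  induction t, h using Int.leInduction with
  | base => simp
  | succ n hn ih =>
    have : Finset.Ico a (n + 1) = insert n (Finset.Ico a n) := by
      ext x; simp; omega
    rw [Hgt_succ, ih, this, Finset.sum_insert (by simp)]; ring

lemma Hgt_per {w : ℤ → ℤ} {R : ℤ} (h : ∀ t, w (t + R) = w t) (t : ℤ) :
    Hgt w (t + R) = Hgt w t + Hgt w R := by
  induction t using Int.induction_on with
  | zero => simp [Hgt_zero]
  | succ i ih =>
    rw [show (i : ℤ) + 1 + R = i + R + 1 by ring, Hgt_succ, Hgt_succ, ih, h]; ring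
  | pred i ih =>
    have h1 := Hgt_succ w (-(i:ℤ) - 1 + R)
    have h2 := Hgt_succ w (-(i:ℤ) - 1)
    rw [show -(i:ℤ) - 1 + R + 1 = -i + R by ring, h, ih] at h1
    rw [sub_add_cancel] at h2
    linarith

lemma sum_nonneg_of_inj (F : Finset ℤ) (w μ : ℤ → ℤ) (hw : ∀ s ∈ F, w s = 1 ∨ w s = -1)
    (hμ : ∀ s ∈ F, w s = -1 → μ s ∈ F ∧ w (μ s) = 1)
    (hinj : ∀ s ∈ F, ∀ t ∈ F, w s = -1 → w t = -1 → μ s = μ t → s = t) : 0 ≤ ∑ i ∈ F, w i := by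
  have h1 : ∑ i ∈ F, w i = ∑ i ∈ F, ((if w i = 1 then 1 else 0) - (if w i = -1 then 1 else 0)) := by
    apply Finset.sum_congr rfl
    intro s hs
    rcases hw s hs with e | e <;> rw [e] <;> norm_num
  rw [h1, Finset.sum_sub_distrib, Finset.sum_boole, Finset.sum_boole, sub_nonneg]
  norm_cast
  apply Finset.card_le_card_of_injOn μ
  · intro s hs
    simp only [Finset.coe_filter, Set.mem_ofPred_eq, Finset.mem_coe, Finset.mem_filter] at hs ⊢
    exact hμ s hs.1 hs.2
  · intro s hs t ht e
    simp only [Finset.coe_filter, Set.mem_ofPred_eq] at hs ht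
    exact hinj s hs.1 t ht.1 hs.2 ht.2 e

open Classical in
noncomputable def wd (r : Bool → ℤ) (J : Bool → ℤ → Bool → ℤ → Prop) (b : Bool) (s : ℤ) : ℤ :=
  if ∃ a, a < s ∧ s < a + 2 * r b ∧ J b s b a then -1 else 1

namespace Mat
variable {r : Bool → ℤ} {J : Bool → ℤ → Bool → ℤ → Prop}

lemma wd_cases (b : Bool) (s : ℤ) : wd r J b s = 1 ∨ wd r J b s = -1 := by
  unfold wd; split_ifs <;> simp

lemma wd_neg {b : Bool} {s : ℤ} : wd r J b s = -1 ↔ ∃ a, a < s ∧ s < a + 2 * r b ∧ J b s b a := by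
  unfold wd; split_ifs with h <;> simp [h]

lemma mate_unique (h : Mat r J) {b s x y} (hx : J b s b x) (hy : J b s b y)
    (x1 : x < s + 2 * r b) (x2 : s < x + 2 * r b) (y1 : y < s + 2 * r b) (y2 : s < y + 2 * r b) :
    x = y := by
  obtain ⟨-, m, hm⟩ := h.func hx hy
  have hr := h.rpos b
  have : m = 0 := by
    by_contra hne
    rcases lt_or_gt_of_ne hne with e | e <;> nlinarith
  subst this; simp at hm; exact hm.symm

lemma wd_left (h : Mat r J) {b a s} (hj : J b a b s) (h1 : a < s) (h2 : s < a + 2 * r b) :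
    wd r J b a = 1 := by
  rcases wd_cases (r := r) (J := J) b a with e | e
  · exact e
  · obtain ⟨a', e1, e2, e3⟩ := wd_neg.mp e
    have := h.mate_unique hj e3 h2 (by omega) (by omega) e2
    omega

lemma wd_right (h : Mat r J) {b a s} (hj : J b a b s) (h1 : a < s) (h2 : s < a + 2 * r b) :
    wd r J b s = -1 := wd_neg.mpr ⟨a, h1, h2, h.symm hj⟩

lemma wd_per (h : Mat r J) (b t) : wd r J b (t + 2 * r b) = wd r J b t := by
  have key : wd r J b (t + 2 * r b) = -1 ↔ wd r J b t = -1 := by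
    rw [wd_neg, wd_neg]
    constructor
    · rintro ⟨a, h1, h2, h3⟩
      refine ⟨a - 2 * r b, by omega, by omega, ?_⟩
      have := h.neg_mul h3 (-1)
      convert this using 1 <;> ring
    · rintro ⟨a, h1, h2, h3⟩
      exact ⟨a + 2 * r b, by omega, by omega, h.neg h3⟩
  have h1 := wd_cases (r := r) (J := J) b t
  have h2 := wd_cases (r := r) (J := J) b (t + 2 * r b)
  omega

lemma sum_ge (h : Mat r J) {b x t} (hx : ∀ a s, x < s → s < t → a < s → s < a + 2 * r b →
    J b s b a → x < a) : 0 ≤ ∑ i ∈ Finset.Ico (x + 1) t, wd r J b i := by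
  classical
  have hch : ∀ s, ∃ a, wd r J b s = -1 → (a < s ∧ s < a + 2 * r b ∧ J b s b a) := by
    intro s
    by_cases e : wd r J b s = -1
    · obtain ⟨a, ha⟩ := wd_neg.mp e
      exact ⟨a, fun _ => ha⟩
    · exact ⟨0, fun h => absurd h e⟩
  choose μ hμ using hch
  apply sum_nonneg_of_inj _ _ μ
  · intro s _; exact wd_cases b s
  · intro s hs e
    obtain ⟨h1, h2, h3⟩ := hμ s e
    simp only [Finset.mem_Ico] at hs ⊢
    have := hx _ s (by omega) hs.2 h1 h2 h3
    exact ⟨⟨by omega, by omega⟩, h.wd_left (h.symm h3) h1 h2⟩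
  · intro s hs t ht e1 e2 e
    obtain ⟨h1, h2, h3⟩ := hμ s e1
    obtain ⟨g1, g2, g3⟩ := hμ t e2
    rw [← e] at g1 g2 g3
    exact h.mate_unique (h.symm h3) (h.symm g3) (by omega) (by omega) (by omega) (by omega)

lemma closed_mate (h : Mat r J) (hp : Planar r J) {b lo hi} (hj : J b lo b hi) (h1 : lo < hi)
    (h2 : hi < lo + 2 * r b) {s a} (hs1 : lo < s) (hs2 : s < hi) (hjs : J b s b a)
    (h3 : a < s + 2 * r b) (h4 : s < a + 2 * r b) : lo < a ∧ a < hi := by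
  obtain ⟨-, m, m1, m2⟩ := h.closed hp hj h1 h2 hs1 hs2 hjs
  have := h.mate_unique hjs (h.shift hjs m) h3 h4 (by omega) (by omega)
  omega

lemma arc_of (h : Mat r J) (hp : Planar r J) {b lo hi} (hj : J b lo b hi) (h1 : lo < hi)
    (h2 : hi < lo + 2 * r b) : Arc (Hgt (wd r J b)) lo hi := by
  have hlo := h.wd_left hj h1 h2
  have hhi := h.wd_right hj h1 h2
  have ge : ∀ t, lo < t → t ≤ hi → 0 ≤ ∑ i ∈ Finset.Ico (lo + 1) t, wd r J b i := by
    intro t t1 t2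
    apply h.sum_ge
    intro a s s1 s2 s3 s4 s5
    exact (h.closed_mate hp hj h1 h2 s1 (by omega) s5 (by omega) s4).1
  have le : 0 ≤ ∑ i ∈ Finset.Ico (lo + 1) hi, - wd r J b i := by
    have hch : ∀ s, ∃ a, lo < s → s < hi →  wd r J b s = 1 →
        (s < a ∧ a < s + 2 * r b ∧ J b s b a ∧ a < hi) := by
      intro s
      by_cases e : lo < s ∧ s < hi ∧ wd r J b s = 1
      · obtain ⟨s1, s2, s3⟩ := e
        obtain ⟨b', s', hs'⟩ := h.total b s
        obtain ⟨rfl, m, m1, m2⟩ := h.closed hp hj h1 h2 s1 s2 hs'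
        have hs'' := h.shift hs' m
        refine ⟨s' + 4 * r b' * m, fun _ _ _ => ?_⟩
        have hpar := h.par hs''
        have : s' + 4 * r b' * m ≠ s := by intro e; rw [e] at hpar; grind
        refine ⟨?_, by omega, hs'', m2⟩
        by_contra hc
        have := (wd_neg (r := r) (b := b')).mpr ⟨_, (by omega : s' + 4 * r b' * m < s), by omega, hs''⟩
        omega
      · exact ⟨0, fun a b c => absurd ⟨a, b, c⟩ e⟩
    choose μ hμ using hch
    apply sum_nonneg_of_inj _ _ μ
    · intro s _; have := wd_cases (r := r) (J := J) b s; omega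
    · intro s hs e
      simp only [Finset.mem_Ico] at hs ⊢
      obtain ⟨g1, g2, g3, g4⟩ := hμ s (by omega) (by omega) (by omega)
      exact ⟨⟨by omega, g4⟩, by rw [h.wd_right g3 g1 g2]; rfl⟩
    · intro s hs t ht e1 e2 e
      simp only [Finset.mem_Ico] at hs ht
      obtain ⟨g1, g2, g3, g4⟩ := hμ s (by omega) (by omega) (by omega)
      obtain ⟨k1, k2, k3, k4⟩ := hμ t (by omega) (by omega) (by omega)
      rw [← e] at k1 k2 k3
      exact h.mate_unique (h.symm g3) (h.symm k3) (by omega) (by omega) (by omega) (by omega)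
  rw [Finset.sum_neg_distrib] at le
  have hval : ∀ t, lo < t → Hgt (wd r J b) t =
      Hgt (wd r J b) lo + 1 + ∑ i ∈ Finset.Ico (lo + 1) t, wd r J b i := by
    intro t ht
    rw [Hgt_sub _ (show lo + 1 ≤ t by omega), Hgt_succ, hlo]
  refine ⟨h1, ?_, ?_⟩
  · rw [Hgt_succ, hval hi h1, hhi]
    have := ge hi h1 le_rfl
    omega
  · intro t t1 t2
    rw [hval t t1]
    have := ge t t1 t2
    omega

lemma th_of (h : Mat r J) (hp : Planar r J) {b s s'} (hj : J b s (!b) s') :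
    Th (Hgt (wd r J b)) s := by
  intro t ht
  have hs : wd r J b s = 1 := by
    rcases wd_cases (r := r) (J := J) b s with e | e
    · exact e
    · obtain ⟨a, -, -, h3⟩ := wd_neg.mp e
      have := (h.func hj h3).1
      simp at this
  rw [Hgt_sub _ (show s + 1 ≤ t by omega), Hgt_succ, hs]
  have : 0 ≤ ∑ i ∈ Finset.Ico (s + 1) t, wd r J b i := by
    apply h.sum_ge
    intro a x x1 x2 x3 x4 x5
    by_contra hc
    rcases eq_or_lt_of_le (not_lt.mp hc) with e | e
    · subst e
      have := (h.func hj (h.symm x5)).1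
      simp at this
    · have := (h.closed hp (h.symm x5) x3 x4 e x1 hj).1
      simp at this
  omega

/-- every slot has closed mate or through -/
lemma mate_cases (h : Mat r J) (b s) : (∃ s', J b s (!b) s') ∨
    (∃ a, J b s b a ∧ a < s + 2 * r b ∧ s < a + 2 * r b ∧ a ≠ s) := by
  obtain ⟨b', s', hs'⟩ := h.total b s
  by_cases hb : b' = b
  · subst hb
    right
    obtain ⟨m, m1, m2⟩ := window (h.rpos b') (s - 2 * r b') s'
    have h1 := h.shift hs' m
    have hodd := h.par h1
    refine ⟨_, h1, ?_, by omega, ?_⟩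
    · rcases eq_or_lt_of_le m2 with e | e
      · rw [e] at hodd; grind
      · omega
    · intro e; rw [e] at hodd; grind
  · left
    have : b' = !b := by revert hb; cases b <;> cases b' <;> simp
    subst this
    exact ⟨s', hs'⟩

lemma th_iff (h : Mat r J) (hp : Planar r J) {b s} :
    Th (Hgt (wd r J b)) s ↔ ∃ s', J b s (!b) s' := by
  constructor
  · intro ht
    rcases h.mate_cases b s with e | ⟨a, h1, h2, h3, h4⟩
    · exact e
    · exfalso
      rcases lt_or_gt_of_ne h4 with e | e
      · exact (h.arc_of hp (h.symm h1) e h3).not_th_right ht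
      · exact (h.arc_of hp h1 e h2).not_th_left ht
  · rintro ⟨s', hs'⟩; exact h.th_of hp hs'

lemma word_of (h : Mat r J) (hp : Planar r J) {b s s'} (hj : J b s (!b) s') :
    ∃ c, Word (r b) c (Hgt (wd r J b)) := by
  have hr := h.rpos b
  have hstep : ∀ t, Hgt (wd r J b) (t + 1) = Hgt (wd r J b) t + 1 ∨
      Hgt (wd r J b) (t + 1) = Hgt (wd r J b) t - 1 := by
    intro t
    rw [Hgt_succ]
    rcases wd_cases (r := r) (J := J) b t with e | e <;> rw [e]
    · left; rfl
    · right; rfl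
  have hper := Hgt_per (w := wd r J b) (R := 2 * r b) (h.wd_per b)
  have hpar : ∀ t : ℕ, Even (Hgt (wd r J b) t - t) := by
    intro t
    induction t with
    | zero => simp [Hgt_zero]
    | succ i ih => push_cast; rcases hstep i with e | e <;> rw [e] <;> grind
  have he := hpar (2 * r b).toNat
  rw [Int.toNat_of_nonneg (by omega)] at he
  obtain ⟨c, hc⟩ : Even (Hgt (wd r J b) (2 * r b)) := by grind
  have := h.th_of hp hj (s + 2 * r b) (by omega)
  rw [hper] at this
  refine ⟨c, hr, by omega, hstep, ?_, Hgt_zero _⟩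
  intro t; rw [hper]; omega

end Mat
end NCBProof

namespace NCBProof
namespace Mat
variable {r : Bool → ℤ} {J : Bool → ℤ → Bool → ℤ → Prop}

lemma th_of' (h : Mat r J) (hp : Planar r J) {b s s'} (hj : J b s (!b) s') :
    Th (Hgt (wd r J (!b))) s' := by
  have : J (!b) s' (!(!b)) s := by rw [Bool.not_not]; exact h.symm hj
  exact h.th_of hp this

lemma next (h : Mat r J) (hp : Planar r J) {b c c'} (W : Word (r b) c (Hgt (wd r J b)))
    (W' : Word (r (!b)) c' (Hgt (wd r J (!b)))) {a x a1} (hj : J b a (!b) x)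
    (ha1 : Th (Hgt (wd r J b)) a1) (e : Hgt (wd r J b) a1 = Hgt (wd r J b) a + 1) :
    ∃ x1, J b a1 (!b) x1 ∧ Hgt (wd r J (!b)) x1 = Hgt (wd r J (!b)) x - 1 := by
  set H := Hgt (wd r J b) with hH
  set H' := Hgt (wd r J (!b)) with hH'
  have ha : Th H a := h.th_of hp hj
  have hx : Th H' x := h.th_of' hp hj
  have l1 : a < a1 := (Th.lt_iff ha ha1).mpr (by omega)
  have l2 : a1 < a + 2 * r b := by
    have t := W.th_shift ha 1
    have p := W.per_mul 1 a
    have := W.cpos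
    rw [mul_one] at t p
    exact (Th.lt_iff ha1 t).mpr (by omega)
  obtain ⟨y, hy⟩ := (h.th_iff hp).mp ha1
  obtain ⟨m, m1, m2⟩ := h.through hp hj l1 l2 hy
  have hx1 := h.shift hy m
  set x1 := y + 4 * r (!b) * m with hx1d
  refine ⟨x1, hx1, ?_⟩
  have tx1 : Th H' x1 := h.th_of' hp hx1
  have lt := (Th.lt_iff tx1 hx).mp m2
  by_contra hne
  obtain ⟨x2, tx2, e2⟩ := W'.exists_level (H' x - 1)
  have l3 : x1 < x2 := (Th.lt_iff tx1 tx2).mpr (by omega)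
  have l4 : x2 < x := (Th.lt_iff tx2 hx).mpr (by omega)
  obtain ⟨y2, hy2⟩ := (h.th_iff hp).mp tx2
  have b1 : J (!b) (x - 2 * r (!b)) (!(!b)) (a + 2 * r b) := by
    have h1 := h.symm (h.neg_mul hj (-1))
    have h2 := h.shift h1 1
    rw [Bool.not_not]
    convert h2 using 1 <;> ring
  have b2 : J (!b) x1 (!(!b)) a1 := by
    rw [Bool.not_not]; exact h.symm hx1
  obtain ⟨n1, n2, n3⟩ := h.through hp b1 (a := x2) (by omega) (by omega) hy2
  obtain ⟨k1, k2, k3⟩ := h.through hp b2 (a := x2) (by omega) (by omega) hy2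
  rw [Bool.not_not] at n2 n3 k2 k3 hy2
  have hr := h.rpos b
  have hk : k1 = n1 := by
    rcases lt_trichotomy k1 n1 with hl | hl | hl
    · have : r b * k1 + r b ≤ r b * n1 := by nlinarith
      linarith
    · exact hl
    · have : r b * n1 + r b ≤ r b * k1 := by nlinarith
      linarith
  subst hk
  have t2 : Th H (y2 + 4 * r b * k1) := h.th_of hp (h.symm (h.shift hy2 k1))
  have q1 := (Th.lt_iff ha t2).mp (by linarith)
  have q2 := (Th.lt_iff t2 ha1).mp (by linarith)
  omega

lemma iter (h : Mat r J) (hp : Planar r J) {b c c'} (W : Word (r b) c (Hgt (wd r J b)))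
    (W' : Word (r (!b)) c' (Hgt (wd r J (!b)))) {a x} (hj : J b a (!b) x) (n : ℕ) :
    ∃ a1 x1, J b a1 (!b) x1 ∧ Hgt (wd r J b) a1 = Hgt (wd r J b) a + n ∧
      Hgt (wd r J (!b)) x1 = Hgt (wd r J (!b)) x - n := by
  induction n with
  | zero => exact ⟨a, x, hj, by simp, by simp⟩
  | succ n ih =>
    obtain ⟨a1, x1, h1, h2, h3⟩ := ih
    obtain ⟨a2, t2, e2⟩ := W.exists_level (Hgt (wd r J b) a1 + 1)
    obtain ⟨x2, hx2, e3⟩ := h.next hp W W' h1 t2 e2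
    exact ⟨a2, x2, hx2, by rw [e2, h2]; push_cast; ring, by rw [e3, h3]; push_cast; ring⟩

lemma levels (h : Mat r J) (hp : Planar r J) {b c c'} (W : Word (r b) c (Hgt (wd r J b)))
    (W' : Word (r (!b)) c' (Hgt (wd r J (!b)))) {a x a' x'} (hj : J b a (!b) x)
    (hj' : J b a' (!b) x') (M : ℤ) (hM : Hgt (wd r J b) a ≤ Hgt (wd r J b) a' + 2 * c * M) :
    ∃ m, Hgt (wd r J b) a + Hgt (wd r J (!b)) x =
      Hgt (wd r J b) a' + Hgt (wd r J (!b)) x' + 2 * (c + c') * M + 4 * c' * m := by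
  have h2 := h.neg_mul hj' M
  obtain ⟨a1, x1, h1, e1, e2⟩ := h.iter hp W W' hj
    (Hgt (wd r J b) a' + 2 * c * M - Hgt (wd r J b) a).toNat
  rw [Int.toNat_of_nonneg (by omega)] at e1 e2
  have p1 := W.per_mul M a'
  have p2 := W'.per_mul M x'
  have : a1 = a' + 2 * r b * M := Th.inj (h.th_of hp h1) (h.th_of hp h2) (by omega)
  subst this
  obtain ⟨-, m, hm⟩ := h.func h2 h1
  refine ⟨m, ?_⟩
  have p3 := W'.per_mul (2 * m) (x' + 2 * r (!b) * M)
  rw [show x' + 2 * r (!b) * M + 2 * r (!b) * (2 * m) = x1 by rw [hm]; ring] at p3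
  linarith

lemma c_dvd (h : Mat r J) (hp : Planar r J) {b c c'} (W : Word (r b) c (Hgt (wd r J b)))
    (W' : Word (r (!b)) c' (Hgt (wd r J (!b)))) {a x} (hj : J b a (!b) x) : c' ∣ c := by
  have hc := W.cpos
  obtain ⟨m, hm⟩ := h.levels hp W W' hj hj 1 (by omega)
  exact ⟨-2 * m - 1, by linarith⟩

theorem main_words (h : Mat r J) (hp : Planar r J) {a x} (hj : J false a true x) :
    ∃ c k : ℤ, (∀ b, Word (r b) c (Hgt (wd r J b))) ∧ Odd k ∧
      ∀ a' x', J false a' true x' →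
        4 * c ∣ Hgt (wd r J false) a' + Hgt (wd r J true) x' - k := by
  obtain ⟨c, W⟩ := h.word_of hp (b := false) hj
  obtain ⟨c', W'⟩ := h.word_of hp (b := true) (h.symm hj)
  have hcc : c = c' := by
    have h1 := h.c_dvd hp (b := false) W W' hj
    have h2 := h.c_dvd hp (b := true) W' W (h.symm hj)
    exact Int.dvd_antisymm W.cpos.le W'.cpos.le h2 h1
  subst hcc
  refine ⟨c, Hgt (wd r J false) a + Hgt (wd r J true) x, ?_, ?_, ?_⟩
  · intro b; cases b
    · exact W
    · exact W'
  · have := W.par a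
    have := W'.par x
    have := h.par hj
    grind
  · intro a' x' hj'
    have hc := W.cpos
    obtain ⟨m, hm⟩ := h.levels hp (b := false) W W' hj hj'
      (|Hgt (wd r J false) a - Hgt (wd r J false) a'|) (by
        have := le_abs_self (Hgt (wd r J false) a - Hgt (wd r J false) a')
        have := abs_nonneg (Hgt (wd r J false) a - Hgt (wd r J false) a')
        nlinarith)
    simp only [Bool.not_false] at hm
    rw [hm]
    exact ⟨-|Hgt (wd r J false) a - Hgt (wd r J false) a'| - m, by ring⟩

end Mat
end NCBProof

namespace NCBProof

def RJ (r : Bool → ℤ) (c : ℤ) (H : Bool → ℤ → ℤ) (k : ℤ) (b : Bool) (s : ℤ) (b' : Bool) (s' : ℤ) :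
    Prop :=
  (b' = b ∧ ∃ m, Arc (H b) s (s' + 4 * r b * m) ∨ Arc (H b) (s' + 4 * r b * m) s) ∨
  (b' = !b ∧ Th (H b) s ∧ Th (H b') s' ∧ 4 * c ∣ H b s + H b' s' - k)

variable {r : Bool → ℤ} {c k : ℤ} {H : Bool → ℤ → ℤ}

lemma Word.arc_shift4 {r c : ℤ} {H : ℤ → ℤ} (h : Word r c H) {a b : ℤ} (hab : Arc H a b) (m : ℤ) :
    Arc H (a + 4 * r * m) (b + 4 * r * m) := by
  have := h.arc_shift hab (2 * m)
  convert this using 1 <;> ring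

lemma Word.arc_mate_unique {r c : ℤ} {H : ℤ → ℤ} (_h : Word r c H) {s x y : ℤ}
    (hx : Arc H s x ∨ Arc H x s) (hy : Arc H s y ∨ Arc H y s) : x = y := by
  rcases hx with hx | hx <;> rcases hy with hy | hy
  · exact hx.right_unique hy
  · exact (hy.not_arc hx).elim
  · exact (hx.not_arc hy).elim
  · exact hx.left_unique hy

lemma RJ_mat (W : ∀ b, Word (r b) c (H b)) (hk : Odd k) : Mat r (RJ r c H k) where
  rpos b := (W b).rpos
  symm := by
    rintro b s b' s' (⟨rfl, m, h⟩ | ⟨rfl, h1, h2, h3⟩)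
    · refine Or.inl ⟨rfl, -m, ?_⟩
      rcases h with h | h
      · right
        have := (W b').arc_shift4 h (-m)
        convert this using 1; ring
      · left
        have := (W b').arc_shift4 h (-m)
        convert this using 1; ring
    · refine Or.inr ⟨by simp, h2, h1, ?_⟩
      convert h3 using 1; ring
  total := by
    intro b s
    rcases (W b).trichotomy s with h | ⟨x, h⟩ | ⟨x, h⟩
    · obtain ⟨x, hx, e⟩ := (W (!b)).exists_level (k - H b s)
      exact ⟨!b, x, Or.inr ⟨rfl, h, hx, by rw [e]; simp⟩⟩
    · exact ⟨b, x, Or.inl ⟨rfl, 0, Or.inl (by simpa using h)⟩⟩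
    · exact ⟨b, x, Or.inl ⟨rfl, 0, Or.inr (by simpa using h)⟩⟩
  func := by
    rintro b s b1 s1 b2 s2 (⟨rfl, m, h⟩ | ⟨rfl, h1, h2, h3⟩) (⟨rfl, m', h'⟩ | ⟨rfl, h1', h2', h3'⟩)
    · refine ⟨rfl, m - m', ?_⟩
      have := (W b2).arc_mate_unique h h'
      linarith
    · rcases h with h | h
      · exact (h.not_th_left h1').elim
      · exact (h.not_th_right h1').elim
    · rcases h' with h | h
      · exact (h.not_th_left h1).elim
      · exact (h.not_th_right h1).elim
    · refine ⟨rfl, ?_⟩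
      have := dvd_sub h3' h3
      obtain ⟨m, hm⟩ := this
      refine ⟨m, ?_⟩
      have e := (W (!b)).per_mul (2 * m) s1
      have t := (W (!b)).th_shift h2 (2 * m)
      have := Th.inj h2' t (by rw [e]; linarith)
      rw [this]; ring
  shift := by
    rintro b s b' s' (⟨rfl, m, h⟩ | ⟨rfl, h1, h2, h3⟩) n
    · refine Or.inl ⟨rfl, m - n, ?_⟩
      rw [show s' + 4 * r b' * n + 4 * r b' * (m - n) = s' + 4 * r b' * m by ring]
      exact h
    · refine Or.inr ⟨rfl, h1, ?_, ?_⟩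
      · have t := (W (!b)).th_shift h2 (2 * n)
        convert t using 1; ring
      · have e := (W (!b)).per_mul (2 * n) s'
        rw [show s' + 4 * r (!b) * n = s' + 2 * r (!b) * (2 * n) by ring, e]
        obtain ⟨j, hj⟩ := h3
        exact ⟨j + n, by linarith⟩
  neg := by
    rintro b s b' s' (⟨rfl, m, h⟩ | ⟨rfl, h1, h2, h3⟩)
    · refine Or.inl ⟨rfl, m, ?_⟩
      rcases h with h | h
      · left
        have := (W b').arc_shift h 1
        convert this using 1 <;> ring
      · right
        have := (W b').arc_shift h 1
        convert this using 1 <;> ring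
    · refine Or.inr ⟨rfl, ?_, ?_, ?_⟩
      · simpa using (W b).th_shift h1 1
      · simpa using (W (!b)).th_shift h2 1
      · rw [(W b).per, (W (!b)).per]
        obtain ⟨j, hj⟩ := h3
        exact ⟨j + 1, by linarith⟩
  par := by
    rintro b s b' s' (⟨rfl, m, h⟩ | ⟨rfl, h1, h2, h3⟩)
    · rcases h with h | h
      · have := (W b').arc_odd h
        rw [show s + (s' + 4 * r b' * m) = s + s' + 2 * (2 * r b' * m) by ring] at this
        grind
      · have := (W b').arc_odd h
        rw [show (s' + 4 * r b' * m) + s = s + s' + 2 * (2 * r b' * m) by ring] at this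
        grind
    · have e1 := (W b).par s
      have e2 := (W (!b)).par s'
      obtain ⟨j, hj⟩ := h3
      obtain ⟨x, hx⟩ := e1
      obtain ⟨y, hy⟩ := e2
      obtain ⟨z, hz⟩ := hk
      refine ⟨2 * c * j + z - x - y, ?_⟩
      linarith

open Classical in
noncomputable def chi (r lo hi t : ℤ) : ℚ := if ∃ m, lo < t + 4 * r * m ∧ t + 4 * r * m ≤ hi then 1 else 0

lemma chi_congr {r lo hi t t' : ℤ} (h : ∀ m, (lo < t + 4 * r * m ∧ t + 4 * r * m ≤ hi) ↔
    (lo < t' + 4 * r * m ∧ t' + 4 * r * m ≤ hi)) : chi r lo hi t = chi r lo hi t' := by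
  unfold chi
  congr 1
  exact propext (exists_congr h)

lemma chi_per (r lo hi t : ℤ) : chi r lo hi (t + 4 * r) = chi r lo hi t := by
  unfold chi
  congr 1
  apply propext
  constructor
  · rintro ⟨m, h⟩
    exact ⟨m + 1, by constructor <;> linarith [h.1, h.2]⟩
  · rintro ⟨m, h⟩
    exact ⟨m - 1, by constructor <;> linarith [h.1, h.2]⟩

noncomputable def Fc (r lo hi t : ℤ) : ℚ := chi r lo hi t - chi r lo hi (t + 2 * r)

lemma Fc_anti (r lo hi t : ℤ) : Fc r lo hi (t + 2 * r) = - Fc r lo hi t := by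
  unfold Fc
  rw [show t + 2 * r + 2 * r = t + 4 * r by ring, chi_per]; ring

lemma Fc_shift (r lo hi m t : ℤ) : Fc r lo hi (t + 4 * r * m) = Fc r lo hi t := by
  have key : ∀ t, Fc r lo hi (t + 4 * r) = Fc r lo hi t := by
    intro t
    unfold Fc
    rw [show t + 4 * r + 2 * r = t + 2 * r + 4 * r by ring, chi_per, chi_per]
  induction m using Int.induction_on generalizing t with
  | zero => simp
  | succ i ih => rw [← ih t, ← key (t + 4 * r * i)]; congr 1; ring
  | pred i ih => rw [← ih t, ← key (t + 4 * r * (-i - 1))]; congr 1; ring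

lemma Fc_congr {r lo hi t t' : ℤ} (h : ∀ m, (lo < t + 2 * r * m ∧ t + 2 * r * m ≤ hi) ↔
    (lo < t' + 2 * r * m ∧ t' + 2 * r * m ≤ hi)) : Fc r lo hi t = Fc r lo hi t' := by
  unfold Fc
  congr 1
  · apply chi_congr
    intro m
    have := h (2 * m)
    rw [show 2 * r * (2 * m) = 4 * r * m by ring] at this
    exact this
  · apply chi_congr
    intro m
    have := h (2 * m + 1)
    rw [show 2 * r * (2 * m + 1) = 2 * r + 4 * r * m by ring] at this
    simpa only [← add_assoc] using this

lemma Fc_zero {r lo hi t : ℤ} (h : ∀ m, ¬ (lo < t + 2 * r * m ∧ t + 2 * r * m ≤ hi)) :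
    Fc r lo hi t = 0 := by
  have h1 : chi r lo hi t = 0 := by
    unfold chi; rw [if_neg]; rintro ⟨m, hm⟩
    apply h (2 * m)
    rwa [show 2 * r * (2 * m) = 4 * r * m by ring]
  have h2 : chi r lo hi (t + 2 * r) = 0 := by
    unfold chi; rw [if_neg]; rintro ⟨m, hm⟩
    apply h (2 * m + 1)
    rw [show 2 * r * (2 * m + 1) = 2 * r + 4 * r * m by ring]
    simpa only [← add_assoc] using hm
  simp [Fc, h1, h2]

lemma Fc_one {r lo hi t : ℤ} (hr : 0 < r) (h1 : lo < t) (h2 : t ≤ hi) (h3 : hi < lo + 2 * r) :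
    Fc r lo hi t = 1 := by
  have e1 : chi r lo hi t = 1 := by
    unfold chi; rw [if_pos]; exact ⟨0, by simpa using ⟨h1, h2⟩⟩
  have e2 : chi r lo hi (t + 2 * r) = 0 := by
    unfold chi; rw [if_neg]; rintro ⟨m, hm1, hm2⟩
    rcases le_or_gt 0 m with hm | hm
    · nlinarith
    · nlinarith
  simp [Fc, e1, e2]

lemma Fc_zero' {r lo hi t : ℤ} (hr : 0 < r) (h1 : t = lo ∨ t = hi + 1) (h3 : hi < lo + 2 * r)
    (h4 : lo < hi) :
    Fc r lo hi t = 0 := by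
  apply Fc_zero
  rintro m ⟨h5, h6⟩
  rcases h1 with rfl | rfl
  · rcases le_or_gt m 0 with hm | hm <;> nlinarith
  · rcases le_or_gt 0 m with hm | hm <;> nlinarith

lemma closed_pot (W : ∀ b, Word (r b) c (H b)) {b0 : Bool} {lo hi : ℤ} (h : Arc (H b0) lo hi) :
    ∃ P : Bool → ℤ → ℚ, (∀ b t, P b (t + 2 * r b) = - P b t) ∧
     (∀ {b s b' s'}, RJ r c H k b s b' s' → P b s = P b' (s' + 1)) ∧
     (P b0 (lo + 1) - P b0 lo = 1) ∧ (P b0 (hi + 1) - P b0 hi = -1) ∧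
     ∀ b s, ¬ (b = b0 ∧ ∃ m, s = lo + 2 * r b0 * m) → ¬ (b = b0 ∧ ∃ m, s = hi + 2 * r b0 * m) →
      P b (s + 1) = P b s := by
  have hr := (W b0).rpos
  have hlt := (W b0).arc_lt h
  refine ⟨fun b t => if b = b0 then Fc (r b0) lo hi t else 0, ?_, ?_, ?_, ?_, ?_⟩
  · intro b t
    dsimp only
    split_ifs with hb
    · rw [hb, Fc_anti]
    · simp
  · rintro b s b' s' (⟨rfl, m, h'⟩ | ⟨rfl, h1, h2, h3⟩)
    · dsimp only
      split_ifs with hb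
      · subst hb
        rcases h' with h' | h'
        · have e1 : Fc (r b') lo hi s = Fc (r b') lo hi (s' + 1 + 4 * r b' * m) := by
            apply Fc_congr
            intro n
            have := h.nest1 ((W b').arc_shift h' n)
            rw [show s' + 1 + 4 * r b' * m + 2 * r b' * n = s' + 4 * r b' * m + 2 * r b' * n + 1 by ring]
            exact this
          rw [e1, Fc_shift]
        · have e1 : Fc (r b') lo hi s = Fc (r b') lo hi (s' + 1 + 4 * r b' * m) := by
            apply Fc_congr
            intro n
            have := h.nest2 ((W b').arc_shift h' n)
            rw [show s' + 1 + 4 * r b' * m + 2 * r b' * n = s' + 4 * r b' * m + 2 * r b' * n + 1 by ring]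
            exact this.symm
          rw [e1, Fc_shift]
      · rfl
    · have z1 : ∀ b s, Th (H b) s → (if b = b0 then Fc (r b0) lo hi s else 0) = 0 := by
        intro b s hs
        split_ifs with hb
        · subst hb
          exact Fc_zero fun m => Th.not_in h ((W b).th_shift hs m)
        · rfl
      have z2 : ∀ b s, Th (H b) s → (if b = b0 then Fc (r b0) lo hi (s + 1) else 0) = 0 := by
        intro b s hs
        split_ifs with hb
        · subst hb
          refine Fc_zero fun m => ?_
          have := Th.not_in' h ((W b).th_shift hs m)
          rwa [show s + 1 + 2 * r b * m = s + 2 * r b * m + 1 by ring]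
        · rfl
      dsimp only
      rw [z1 _ _ h1, z2 _ _ h2]
  · simp only [if_true]
    rw [Fc_one hr (by omega) (by have := h.1; omega) hlt, Fc_zero' hr (Or.inl rfl) hlt h.1]; simp
  · simp only [if_true]
    rw [Fc_one hr h.1 le_rfl hlt, Fc_zero' hr (Or.inr rfl) hlt h.1]; simp
  · intro b s n1 n2
    dsimp only
    split_ifs with hb
    · subst hb
      apply Fc_congr
      intro m
      have e1 : s + 2 * r b * m ≠ lo := by
        intro e; exact n1 ⟨rfl, -m, by linarith⟩
      have e2 : s + 2 * r b * m ≠ hi := by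
        intro e; exact n2 ⟨rfl, -m, by linarith⟩
      constructor
      · rintro ⟨_, _⟩; constructor <;> omega
      · rintro ⟨_, _⟩; constructor <;> omega
    · rfl

def sg (n : ℤ) : ℚ := if Even n then 1 else -1

lemma sg_succ (n : ℤ) : sg (n + 1) = - sg n := by
  unfold sg; split_ifs <;> grind

lemma sg_neg (n : ℤ) : sg (-n) = sg n := by
  unfold sg; simp

lemma sg_add_even (n m : ℤ) : sg (n + 2 * m) = sg n := by
  unfold sg
  congr 1
  apply propext
  constructor <;> grind

lemma sg_cases (n : ℤ) : sg n = 1 ∨ sg n = -1 := by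
  unfold sg; split_ifs <;> simp

lemma div_eq_of_iff {R R' x y : ℤ} (hR : 0 < R) (hR' : 0 < R')
    (h : ∀ n, R * n ≤ x ↔ R' * n ≤ y) : x / R = y / R' := by
  apply le_antisymm
  · rw [Int.le_ediv_iff_mul_le hR', mul_comm, ← h, mul_comm]
    exact Int.ediv_mul_le _ hR.ne'
  · rw [Int.le_ediv_iff_mul_le hR, mul_comm, h, mul_comm]
    exact Int.ediv_mul_le _ hR'.ne'

noncomputable def tp (r : Bool → ℤ) (ε : Bool → ℚ) (sl : Bool → ℤ) (b : Bool) (t : ℤ) : ℚ :=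
  ε b / 2 * sg ((t - sl b - 1) / (2 * r b))

lemma th_div {r0 : ℤ} {H0 : ℤ → ℤ} (W : Word r0 c H0) {s a : ℤ} (hs : Th H0 s) (ha : Th H0 a) :
    (a - s - 1) / (2 * r0) = (H0 a - H0 s - 1) / (2 * c) := by
  have hr := W.rpos
  have hc := W.cpos
  apply div_eq_of_iff (by omega) (by omega)
  intro n
  have := Th.lt_iff (W.th_shift hs n) ha
  rw [W.per_mul] at this
  constructor
  · intro h; have := this.mp (by linarith); linarith
  · intro h; have := this.mpr (by linarith); linarith

lemma th_div' {r0 : ℤ} {H0 : ℤ → ℤ} (W : Word r0 c H0) {s a : ℤ} (hs : Th H0 s) (ha : Th H0 a) :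
    (a - s) / (2 * r0) = (H0 a - H0 s) / (2 * c) := by
  have hr := W.rpos
  have hc := W.cpos
  apply div_eq_of_iff (by omega) (by omega)
  intro n
  have := Th.le_iff (W.th_shift hs n) ha
  rw [W.per_mul] at this
  constructor
  · intro h; have := this.mp (by linarith); linarith
  · intro h; have := this.mpr (by linarith); linarith

lemma neg_div_aux {D C : ℤ} (hC : 0 < C) : (-D) / C = -((D - 1) / C + 1) := by
  have h1 := Int.mul_ediv_add_emod (D - 1) C
  have h2 := Int.emod_nonneg (D - 1) hC.ne'
  have h3 := Int.emod_lt_of_pos (D - 1) hC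
  rw [Int.ediv_eq_iff_of_pos hC]
  constructor <;> nlinarith

lemma tp_shift (hr : ∀ b, 0 < r b) (ε : Bool → ℚ) (sl : Bool → ℤ) (b : Bool) (m t : ℤ) :
    tp r ε sl b (t + 4 * r b * m) = tp r ε sl b t := by
  unfold tp
  have := hr b
  rw [show t + 4 * r b * m - sl b - 1 = (t - sl b - 1) + (2 * r b) * (2 * m) by ring,
    Int.add_mul_ediv_left _ _ (by omega), sg_add_even]

lemma tp_swap (W : ∀ b, Word (r b) c (H b)) {ε : Bool → ℚ} {sl : Bool → ℤ}
    (hε : ∀ b, ε (!b) = - ε b) (hs : ∀ b, Th (H b) (sl b))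
    (hsl : 4 * c ∣ H false (sl false) + H true (sl true) - k)
    {b s b' s'} (hj : RJ r c H k b s b' s') : tp r ε sl b s = tp r ε sl b' (s' + 1) := by
  have hr : ∀ b, 0 < r b := fun b => (W b).rpos
  rcases hj with ⟨rfl, m, h⟩ | ⟨rfl, h1, h2, h3⟩
  · rw [← tp_shift hr ε sl b' m (s' + 1), show s' + 1 + 4 * r b' * m = s' + 4 * r b' * m + 1 by ring]
    have hr := hr b'
    generalize s' + 4 * r b' * m = x at h ⊢
    unfold tp
    congr 2
    apply div_eq_of_iff (by omega) (by omega)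
    intro n
    rcases h with h | h
    · have := Th.sep1 h ((W b').th_shift (hs b') n)
      omega
    · have := Th.sep2 h ((W b').th_shift (hs b') n)
      omega
  · have hsl' : 4 * c ∣ H b (sl b) + H (!b) (sl (!b)) - k := by
      cases b
      · exact hsl
      · simpa [add_comm] using hsl
    obtain ⟨j, hj⟩ := dvd_sub h3 hsl'
    unfold tp
    rw [th_div (W b) (hs b) h1, show s' + 1 - sl (!b) - 1 = s' - sl (!b) by ring,
      th_div' (W (!b)) (hs (!b)) h2, hε]
    have hc := (W b).cpos
    rw [show H (!b) s' - H (!b) (sl !b) = -(H b s - H b (sl b)) + (2 * c) * (2 * j) by linarith,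
      Int.add_mul_ediv_left _ _ (by omega), sg_add_even, neg_div_aux (by omega), sg_neg, sg_succ]
    ring

lemma tp_anti (hr : ∀ b, 0 < r b) (ε : Bool → ℚ) (sl : Bool → ℤ) (b : Bool) (t : ℤ) :
    tp r ε sl b (t + 2 * r b) = - tp r ε sl b t := by
  unfold tp
  have := hr b
  rw [show t + 2 * r b - sl b - 1 = (t - sl b - 1) + (2 * r b) * 1 by ring,
    Int.add_mul_ediv_left _ _ (by omega), sg_succ]
  ring

lemma tp_const (hr : ∀ b, 0 < r b) (ε : Bool → ℚ) (sl : Bool → ℤ) {b : Bool} {s : ℤ}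
    (h : ¬ ∃ m, s = sl b + 2 * r b * m) : tp r ε sl b (s + 1) = tp r ε sl b s := by
  unfold tp
  have := hr b
  congr 2
  apply div_eq_of_iff (by omega) (by omega)
  intro n
  have : s ≠ sl b + 2 * r b * n := fun e => h ⟨n, e⟩
  omega

/-- The potential attached to an even through slot. -/
lemma through_pot (W : ∀ b, Word (r b) c (H b)) (hk : Odd k) {b0 s0} (he : Even s0)
    (hs : Th (H b0) s0) :
    ∃ P, IsPot r (RJ r c H k) b0 s0 P ∧ (∀ t, P b0 t = 1 / 2 * sg ((t - s0 - 1) / (2 * r b0))) ∧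
      ∀ b t, P b t ≠ 0 := by
  have hr : ∀ b, 0 < r b := fun b => (W b).rpos
  obtain ⟨x, hx, ex⟩ := (W (!b0)).exists_level (k - H b0 s0)
  set sl : Bool → ℤ := fun b => if b = b0 then s0 else x with hsl
  set ε : Bool → ℚ := fun b => if b = b0 then 1 else -1 with hε
  have sl0 : sl b0 = s0 := by simp [hsl]
  have sl1 : sl (!b0) = x := by simp [hsl]
  have ε0 : ε b0 = 1 := by simp [hε]
  have hth : ∀ b, Th (H b) (sl b) := by
    intro b
    by_cases hb : b = b0
    · subst hb; rwa [sl0]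
    · have : b = !b0 := by cases b <;> cases b0 <;> simp_all
      subst this; rwa [sl1]
  refine ⟨tp r ε sl, ⟨tp_anti hr ε sl, ?_, ?_, ?_⟩, ?_, ?_⟩
  · intro b s b' s' hj
    refine tp_swap W ?_ hth ?_ hj
    · intro b; cases b <;> cases b0 <;> simp [hε]
    · have : H b0 (sl b0) + H (!b0) (sl (!b0)) - k = 0 := by rw [sl0, sl1, ex]; ring
      cases b0
      · simp only [Bool.not_false] at this; rw [this]; simp
      · simp only [Bool.not_true] at this; rw [add_comm, this]; simp
  · have := hr b0
    unfold tp
    rw [sl0, ε0, show s0 + 1 - s0 - 1 = 0 by ring, show s0 - s0 - 1 = -1 by ring,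
      Int.zero_ediv, show (-1 : ℤ) / (2 * r b0) = -1 from Int.ediv_eq_neg_one_of_neg_of_le (by omega) (by omega)]
    norm_num [sg]
  · intro b s hs' hn
    apply tp_const hr
    rintro ⟨m, hm⟩
    by_cases hb : b = b0
    · subst hb; exact hn ⟨rfl, m, by rw [hm, sl0]⟩
    · have : b = !b0 := by cases b <;> cases b0 <;> simp_all
      subst this
      rw [sl1] at hm
      have p1 := (W b0).par s0
      have p2 := (W (!b0)).par x
      rw [ex] at p2
      rw [mul_assoc] at hm
      grind
  · intro t; unfold tp; rw [sl0, ε0]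
  · intro b t; unfold tp
    have : ε b ≠ 0 := by simp only [hε]; split_ifs <;> norm_num
    rcases sg_cases ((t - sl b - 1) / (2 * r b)) with e | e <;> rw [e] <;> simpa using this

theorem RJ_planar (W : ∀ b, Word (r b) c (H b)) (hk : Odd k) : Planar r (RJ r c H k) := by
  intro b0 s0 he
  rcases (W b0).trichotomy s0 with h | ⟨x, h⟩ | ⟨x, h⟩
  · obtain ⟨P, hP, -⟩ := through_pot W hk he h
    exact ⟨P, hP⟩
  · obtain ⟨P, h1, h2, h3, h4, h5⟩ := closed_pot (k := k) W h
    refine ⟨P, h1, h2, h3, ?_⟩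
    intro b s hs hn
    refine h5 b s hn ?_
    rintro ⟨rfl, m, hm⟩
    have := (W b).arc_odd h
    rw [mul_assoc] at hm
    grind
  · obtain ⟨P, h1, h2, h3, h4, h5⟩ := closed_pot (k := k) W h
    refine ⟨fun b t => - P b t, ?_, ?_, ?_, ?_⟩
    · intro b t; rw [h1]
    · intro b s b' s' hj; rw [h2 hj]
    · linarith
    intro b s hs hn
    rw [h5 b s ?_ hn]
    rintro ⟨rfl, m, hm⟩
    have := (W b).arc_odd h
    rw [mul_assoc] at hm
    grind

lemma RJ_wd (W : ∀ b, Word (r b) c (H b)) (hk : Odd k) (b : Bool) (s : ℤ) :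
    H b (s + 1) = H b s + wd r (RJ r c H k) b s := by
  have hM := RJ_mat W hk
  rcases (W b).trichotomy s with h | ⟨x, h⟩ | ⟨x, h⟩
  · have h1 := h (s + 1) (by omega)
    have h2 := (W b).step s
    rcases Mat.wd_cases (r := r) (J := RJ r c H k) b s with e | e
    · rw [e]; omega
    · obtain ⟨a, -, -, h5⟩ := Mat.wd_neg.mp e
      rcases h5 with ⟨-, m, h5 | h5⟩ | ⟨h5, -⟩
      · exact (h5.not_th_left h).elim
      · exact (h5.not_th_right h).elim
      · simp at h5
  · rw [hM.wd_left (s := x) (Or.inl ⟨rfl, 0, Or.inl (by simpa using h)⟩) h.1 ((W b).arc_lt h)]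
    have h1 := h.2.2 (s + 1) (by omega) (by have := h.1; omega)
    have h2 := (W b).step s
    omega
  · rw [hM.wd_right (a := x) (Or.inl ⟨rfl, 0, Or.inl (by simpa using h)⟩) h.1 ((W b).arc_lt h)]
    have h1 := h.2.2 s h.1 le_rfl
    have h3 := h.2.1
    have h2 := (W b).step s
    omega

/-- A planar matching with a through pair is contained in the matching of its words. -/
theorem exists_words {J : Bool → ℤ → Bool → ℤ → Prop} (h : Mat r J) (hp : Planar r J) {a x}
    (hj : J false a true x) :
    ∃ c k : ℤ, (∀ b, Word (r b) c (Hgt (wd r J b))) ∧ Odd k ∧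
      ∀ {b s b' s'}, J b s b' s' → RJ r c (fun b => Hgt (wd r J b)) k b s b' s' := by
  obtain ⟨c, k, W, hk, hth⟩ := h.main_words hp hj
  refine ⟨c, k, W, hk, ?_⟩
  intro b s b' s' hs
  rcases h.mate_cases b s with ⟨y, hy⟩ | ⟨y, h1, h2, h3, h4⟩
  · obtain ⟨rfl, -⟩ := h.func hy hs
    refine Or.inr ⟨rfl, h.th_of hp hs, h.th_of' hp hs, ?_⟩
    cases b
    · exact hth _ _ hs
    · have := hth _ _ (h.symm hs)
      simp only [Bool.not_true]
      rwa [add_comm (Hgt (wd r J true) s)]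
  · obtain ⟨rfl, m, hm⟩ := h.func h1 hs
    refine Or.inl ⟨rfl, -m, ?_⟩
    rw [hm, show y + 4 * r b * m + 4 * r b * -m = y by ring]
    rcases lt_or_gt_of_ne h4 with h5 | h5
    · right; exact h.arc_of hp (h.symm h1) h5 h3
    · left; exact h.arc_of hp h1 h5 h2

end NCBProof

namespace NCBProof

def VB (n : ℕ) : Submodule ℚ (ℤ → ℚ) where
  carrier := {f | (∀ x, f (-x) = - f x) ∧ ∀ x, x ∉ signedSet n → f x = 0}
  add_mem' := by
    rintro f g ⟨h1, h2⟩ ⟨h3, h4⟩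
    refine ⟨fun x => ?_, fun x hx => ?_⟩
    · simp only [Pi.add_apply, h1, h3]; ring
    · simp only [Pi.add_apply, h2 x hx, h4 x hx]; ring
  zero_mem' := by simp
  smul_mem' := by
    rintro a f ⟨h1, h2⟩
    refine ⟨fun x => ?_, fun x hx => ?_⟩
    · simp only [Pi.smul_apply, smul_eq_mul, h1]; ring
    · simp only [Pi.smul_apply, smul_eq_mul, h2 x hx]; ring

lemma mem_VB {n : ℕ} {f : ℤ → ℚ} :
    f ∈ VB n ↔ (∀ x, f (-x) = - f x) ∧ ∀ x, x ∉ signedSet n → f x = 0 := Iff.rfl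

lemma mem_ss {n : ℕ} {x : ℤ} : x ∈ signedSet n ↔ x ≠ 0 ∧ |x| ≤ n := Iff.rfl

lemma neg_ss {n : ℕ} {x : ℤ} : -x ∈ signedSet n ↔ x ∈ signedSet n := by simp [mem_ss]

lemma VB_zero {n : ℕ} {f : ℤ → ℚ} (hf : f ∈ VB n) : f 0 = 0 := hf.2 0 (by simp [mem_ss])

/-- Odd extension. -/
def ext (n : ℕ) (g : Fin n → ℚ) (x : ℤ) : ℚ :=
  (if h : 1 ≤ x ∧ x ≤ n then g ⟨(x - 1).toNat, by omega⟩ else 0) -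
  (if h : 1 ≤ -x ∧ -x ≤ n then g ⟨(-x - 1).toNat, by omega⟩ else 0)

lemma ext_mem (n : ℕ) (g : Fin n → ℚ) : ext n g ∈ VB n := by
  constructor
  · intro x
    unfold ext
    simp only [neg_neg]
    ring
  · intro x hx
    unfold ext
    rw [mem_ss] at hx
    rw [dif_neg, dif_neg]
    · simp
    · rintro ⟨h1, h2⟩; apply hx; refine ⟨by omega, ?_⟩; rw [abs_le]; omega
    · rintro ⟨h1, h2⟩; apply hx; refine ⟨by omega, ?_⟩; rw [abs_le]; omega

lemma VB_ext {n : ℕ} {f g : ℤ → ℚ} (hf : f ∈ VB n) (hg : g ∈ VB n)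
    (h : ∀ i : Fin n, f ((i : ℤ) + 1) = g ((i : ℤ) + 1)) : f = g := by
  have key : ∀ x : ℤ, 1 ≤ x → x ≤ n → f x = g x := by
    intro x h1 h2
    have := h ⟨(x - 1).toNat, by omega⟩
    simp only at this
    rwa [show (((x - 1).toNat : ℕ) : ℤ) + 1 = x by omega] at this
  funext x
  by_cases hx : x ∈ signedSet n
  · rw [mem_ss, abs_le] at hx
    rcases lt_or_gt_of_ne hx.1 with h1 | h1
    · have := key (-x) (by omega) (by omega)
      rw [hf.1, hg.1] at this
      linarith
    · exact key x (by omega) (by omega)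
  · rw [hf.2 x hx, hg.2 x hx]

def VBmap (n : ℕ) : VB n →ₗ[ℚ] (Fin n → ℚ) where
  toFun f i := f.1 ((i : ℤ) + 1)
  map_add' f g := rfl
  map_smul' a f := rfl

noncomputable def VBequiv (n : ℕ) : VB n ≃ₗ[ℚ] (Fin n → ℚ) :=
  LinearEquiv.ofBijective (VBmap n) (by
    constructor
    · intro f g h
      apply Subtype.ext
      exact VB_ext f.2 g.2 fun i => congrFun h i
    · intro g
      refine ⟨⟨ext n g, ext_mem n g⟩, ?_⟩
      funext i
      change ext n g ((i : ℤ) + 1) = g i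
      unfold ext
      have := i.2
      rw [dif_pos (by omega), dif_neg (by omega)]
      simp)

instance (n : ℕ) : FiniteDimensional ℚ (VB n) := Module.Finite.equiv (VBequiv n).symm

lemma finrank_VB (n : ℕ) : Module.finrank ℚ (VB n) = n := by
  rw [LinearEquiv.finrank_eq (VBequiv n)]; simp

def FixB (n : ℕ) (τ : Equiv.Perm ℤ) : Submodule ℚ (VB n) where
  carrier := {f | ∀ x, f.1 (τ x) = f.1 x}
  add_mem' := by
    intro f g hf hg x
    simp only [Submodule.coe_add, Pi.add_apply, hf x, hg x]
  zero_mem' := by intro x; simp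
  smul_mem' := by
    intro a f hf x
    simp only [Submodule.coe_smul, Pi.smul_apply, hf x]

lemma mem_Fix {n : ℕ} {τ : Equiv.Perm ℤ} {f : VB n} : f ∈ FixB n τ ↔ ∀ x, f.1 (τ x) = f.1 x := Iff.rfl

def EB (x z : ℤ) : ℚ := (if z = x then 1 else 0) - (if z = -x then 1 else 0)

lemma EB_mem {n : ℕ} {x : ℤ} (hx : x ∈ signedSet n) : EB x ∈ VB n := by
  constructor
  · intro z; unfold EB
    simp only [neg_eq_iff_eq_neg, neg_neg]
    ring
  · intro z hz; unfold EB
    rw [if_neg (by rintro rfl; exact hz hx), if_neg (by rintro rfl; exact hz (neg_ss.mpr hx))]; simp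

lemma EB_one {n : ℕ} {x z : ℤ} (hx : x ∈ signedSet n) : EB x z = 1 ↔ z = x := by
  have := hx.1
  unfold EB
  constructor
  · intro h
    by_contra hne
    rw [if_neg hne] at h
    split_ifs at h <;> norm_num at h
  · rintro rfl
    rw [if_pos rfl, if_neg (by omega)]; simp

lemma gen_fix {n : ℕ} {g : Equiv.Perm ℤ} (hg : g ∈ genB n) :
    ∃ x y, ∀ f ∈ VB n, f x = f y → ∀ z, f (g z) = f z := by
  have swp : ∀ (f : ℤ → ℚ) x y, f x = f y → ∀ z, f (Equiv.swap x y z) = f z := by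
    intro f x y h z
    rw [Equiv.swap_apply_def]; split_ifs <;> simp_all
  rcases hg with ⟨i, j, -, -, -, -, -, rfl⟩ | ⟨i, j, -, -, -, -, -, rfl⟩ | ⟨i, -, -, rfl⟩
  · refine ⟨i, j, fun f hf h z => ?_⟩
    rw [Equiv.Perm.mul_apply, swp f _ _ h, swp f _ _ (by rw [hf.1, hf.1, h])]
  · refine ⟨i, -j, fun f hf h z => ?_⟩
    rw [Equiv.Perm.mul_apply, swp f _ _ h, swp f _ _ (by rw [hf.1, h, hf.1, neg_neg])]
  · exact ⟨i, -i, fun f hf h z => swp f _ _ h z⟩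

lemma gen_prop {n : ℕ} {x y : ℤ} (hx : x ∈ signedSet n) (hy : y ∈ signedSet n) (hxy : x ≠ y)
    (hxy' : y ≠ -x) {g : Equiv.Perm ℤ} (hg : g = Equiv.swap x y * Equiv.swap (-x) (-y)) :
    g y = x ∧ inB n g ∧ g * g = 1 ∧
      ∀ f ∈ VB n, f x = f y → ∀ z, f (g z) = f z := by
  have hx0 := hx.1
  have hy0 := hy.1
  have app : ∀ z, g z = if z = x then y else if z = y then x else if z = -x then -y else
      if z = -y then -x else z := by
    intro z
    rw [hg, Equiv.Perm.mul_apply, Equiv.swap_apply_def, Equiv.swap_apply_def]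
    split_ifs <;> omega
  refine ⟨?_, ⟨?_, ?_⟩, ?_, ?_⟩
  · rw [app]; split_ifs <;> omega
  · intro z; rw [app, app]; split_ifs <;> omega
  · intro z hz
    rw [app]
    have h1 : z ≠ x := by rintro rfl; exact hz hx
    have h2 : z ≠ y := by rintro rfl; exact hz hy
    have h3 : z ≠ -x := by rintro rfl; exact hz (neg_ss.mpr hx)
    have h4 : z ≠ -y := by rintro rfl; exact hz (neg_ss.mpr hy)
    simp [h1, h2, h3, h4]
  · ext z
    rw [Equiv.Perm.mul_apply, app (g z), app z, Equiv.Perm.one_apply]; split_ifs <;> omega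
  · intro f hf h z
    have h1 := hf.1 x
    have h2 := hf.1 y
    rw [app]; split_ifs with e1 e2 e3 e4
    · rw [e1, h]
    · rw [e2, h]
    · rw [e3, h1, h2, h]
    · rw [e4, h1, h2, h]
    · rfl

lemma exists_gen {n : ℕ} {x y : ℤ} (hx : x ∈ signedSet n) (hy : y ∈ signedSet n) (hxy : x ≠ y) :
    ∃ g ∈ genB n, g y = x ∧ inB n g ∧ g * g = 1 ∧
      ∀ f ∈ VB n, f x = f y → ∀ z, f (g z) = f z := by
  have hx0 := hx.1
  have hy0 := hy.1
  have hx1 := hx.2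
  have hy1 := hy.2
  rw [abs_le] at hx1 hy1
  by_cases hxy' : y = -x
  · subst hxy'
    refine ⟨Equiv.swap x (-x), ?_, by simp, ⟨?_, ?_⟩, by simp, ?_⟩
    · right; right
      rcases lt_or_gt_of_ne hx0 with h | h
      · exact ⟨-x, by omega, by omega, by rw [neg_neg, Equiv.swap_comm]⟩
      · exact ⟨x, by omega, by omega, rfl⟩
    · intro z; rw [Equiv.swap_apply_def, Equiv.swap_apply_def]; split_ifs <;> omega
    · intro z hz
      rw [Equiv.swap_apply_of_ne_of_ne]
      · rintro rfl; exact hz hx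
      · rintro rfl; exact hz hy
    · intro f hf h z
      rw [Equiv.swap_apply_def]; split_ifs <;> simp_all
  · have key := gen_prop hx hy hxy hxy' rfl
    rcases lt_or_gt_of_ne hx0 with h | h <;> rcases lt_or_gt_of_ne hy0 with h' | h'
    · obtain ⟨k1, k2, k3, k4⟩ := gen_prop (neg_ss.mpr hx) (neg_ss.mpr hy) (by omega) (by omega) rfl
      refine ⟨_, Or.inl ⟨-x, -y, by omega, by omega, by omega, by omega, by omega, rfl⟩, ?_, k2, k3, ?_⟩
      · have := k2.1 (-y)
        rw [k1] at this
        simpa only [neg_neg] using this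
      · intro f hf e z
        exact k4 f hf (by rw [hf.1, hf.1, e]) z
    · refine ⟨_, Or.inr (Or.inl ⟨y, -x, by omega, by omega, by omega, by omega, by omega, ?_⟩), key⟩
      rw [neg_neg, Equiv.swap_comm y x, Equiv.swap_comm (-y) (-x)]
    · refine ⟨_, Or.inr (Or.inl ⟨x, -y, by omega, by omega, by omega, by omega, by omega, ?_⟩), key⟩
      rw [neg_neg]
    · exact ⟨_, Or.inl ⟨x, y, by omega, by omega, by omega, by omega, by omega, rfl⟩, key⟩
lemma fix_mul_gen {n : ℕ} {g : Equiv.Perm ℤ} (hg : g ∈ genB n) (σ : Equiv.Perm ℤ) :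
    Module.finrank ℚ (FixB n σ) ≤ Module.finrank ℚ (FixB n (g * σ)) + 1 := by
  obtain ⟨x, y, h⟩ := gen_fix hg
  let φ : FixB n σ →ₗ[ℚ] ℚ :=
    { toFun := fun f => f.1.1 x - f.1.1 y
      map_add' := by intro f g; simp; ring
      map_smul' := by intro a f; simp; ring }
  have h1 := LinearMap.finrank_range_add_finrank_ker (K := ℚ) (V := FixB n σ) (V₂ := ℚ) φ
  have h2 : Module.finrank ℚ (LinearMap.range φ) ≤ 1 := by
    have := Submodule.finrank_le (LinearMap.range φ)
    simpa using this
  have h3 : Module.finrank ℚ (LinearMap.ker φ) ≤ Module.finrank ℚ (FixB n (g * σ)) := by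
    let ψ : LinearMap.ker φ →ₗ[ℚ] FixB n (g * σ) :=
      { toFun := fun f => ⟨f.1.1, by
          intro z
          have hf : f.1.1.1 x - f.1.1.1 y = 0 := f.2
          rw [Equiv.Perm.mul_apply, h _ f.1.1.2 (by linarith)]
          exact f.1.2 z⟩
        map_add' := fun f g => rfl
        map_smul' := fun a f => rfl }
    apply LinearMap.finrank_le_finrank_of_injective (f := ψ)
    intro f g hfg
    apply Subtype.ext; apply Subtype.ext
    exact congrArg (fun t => t.1) hfg
  omega

lemma fix_one (n : ℕ) : Module.finrank ℚ (FixB n 1) = n := by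
  have : FixB n 1 = ⊤ := by
    rw [eq_top_iff]; intro f _ x; simp
  rw [this, finrank_top, finrank_VB]

lemma le_of_list {n : ℕ} (l : List (Equiv.Perm ℤ)) (hl : ∀ g ∈ l, g ∈ genB n) :
    n ≤ Module.finrank ℚ (FixB n l.prod) + l.length := by
  induction l with
  | nil => rw [List.prod_nil, fix_one]; simp
  | cons g l ih =>
    have h1 := ih fun a ha => hl a (List.mem_cons_of_mem _ ha)
    have h2 := fix_mul_gen (hl g (by simp)) l.prod
    rw [List.prod_cons, List.length_cons]
    omega

lemma inB_mem {n : ℕ} {τ : Equiv.Perm ℤ} (h : inB n τ) {x : ℤ} (hx : x ∈ signedSet n) :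
    τ x ∈ signedSet n := by
  by_contra hn
  have := h.2 _ hn
  have := τ.injective this
  rw [this] at hn
  exact hn hx

lemma inB_mul {n : ℕ} {σ τ : Equiv.Perm ℤ} (h : inB n σ) (h' : inB n τ) : inB n (σ * τ) := by
  constructor
  · intro x; simp [h.1, h'.1]
  · intro x hx; simp [h.2 x hx, h'.2 x hx]

lemma inB_inv {n : ℕ} {σ : Equiv.Perm ℤ} (h : inB n σ) : inB n σ⁻¹ := by
  constructor
  · intro x
    rw [Equiv.Perm.inv_eq_iff_eq, h.1]; simp
  · intro x hx
    rw [Equiv.Perm.inv_eq_iff_eq, h.2 x hx]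

lemma exists_list {n : ℕ} (d : ℕ) : ∀ (τ : Equiv.Perm ℤ), inB n τ →
    n ≤ Module.finrank ℚ (FixB n τ) + d →
    ∃ l : List (Equiv.Perm ℤ), l.length + Module.finrank ℚ (FixB n τ) ≤ n ∧
      (∀ g ∈ l, g ∈ genB n) ∧ l.prod = τ := by
  induction d with
  | zero =>
    intro τ hτ hd
    have htop : FixB n τ = ⊤ := by
      apply Submodule.eq_top_of_finrank_eq
      have := Submodule.finrank_le (FixB n τ)
      rw [finrank_VB] at *
      omega
    refine ⟨[], ?_, by simp, ?_⟩
    · rw [htop, finrank_top, finrank_VB]; simp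
    · rw [List.prod_nil]
      ext x
      by_cases hx : x ∈ signedSet n
      · have : (⟨EB x, EB_mem hx⟩ : VB n) ∈ FixB n τ := by rw [htop]; trivial
        have h1 := this x
        simp only [(EB_one hx).mpr] at h1
        rw [EB_one hx] at h1
        simp [h1]
      · simp [hτ.2 x hx]
  | succ d ih =>
    intro τ hτ hd
    by_cases hle : n ≤ Module.finrank ℚ (FixB n τ) + d
    · exact ih τ hτ hle
    have hne : ∃ x ∈ signedSet n, τ x ≠ x := by
      by_contra hcon
      push Not at hcon
      have : τ = 1 := by
        ext x
        by_cases hx : x ∈ signedSet n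
        · simp [hcon x hx]
        · simp [hτ.2 x hx]
      subst this
      rw [fix_one] at hle
      omega
    obtain ⟨x, hx, hne⟩ := hne
    obtain ⟨g, hg, hgy, hgB, hgg, hf⟩ := exists_gen hx (inB_mem hτ hx) hne.symm
    have hle' : FixB n τ ≤ FixB n (g * τ) := by
      intro f hfm z
      rw [Equiv.Perm.mul_apply, hf f.1 f.2 (hfm x).symm, hfm z]
    have hlt : FixB n τ < FixB n (g * τ) := by
      refine lt_of_le_of_ne hle' ?_
      intro he
      have hE : (⟨EB x, EB_mem hx⟩ : VB n) ∈ FixB n (g * τ) := by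
        intro z
        have e : ∀ a b, (g * τ) a = b ∨ True := by simp
        have h1 : (g * τ) x = x := by simp [hgy]
        have h2 : (g * τ) (-x) = -x := by rw [(inB_mul hgB hτ).1, h1]
        have h3 : ∀ w, ((g * τ) w = x ↔ w = x) := fun w =>
          ⟨fun h => (g * τ).injective (h.trans h1.symm), fun h => by rw [h, h1]⟩
        have h4 : ∀ w, ((g * τ) w = -x ↔ w = -x) := fun w =>
          ⟨fun h => (g * τ).injective (h.trans h2.symm), fun h => by rw [h, h2]⟩
        simp only [EB, h3, h4]
      rw [← he] at hE
      have h1 := hE x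
      simp only [(EB_one hx).mpr] at h1
      rw [EB_one hx] at h1
      exact hne h1
    have hfr := Submodule.finrank_lt_finrank_of_lt hlt
    obtain ⟨l, h1, h2, h3⟩ := ih (g * τ) (inB_mul hgB hτ) (by omega)
    refine ⟨g :: l, ?_, ?_, ?_⟩
    · rw [List.length_cons]; omega
    · intro a ha
      rcases List.mem_cons.mp ha with rfl | ha
      · exact hg
      · exact h2 a ha
    · rw [List.prod_cons, h3, ← mul_assoc, hgg, one_mul]

theorem lenB_add {n : ℕ} {τ : Equiv.Perm ℤ} (hτ : inB n τ) :
    lenB n τ + Module.finrank ℚ (FixB n τ) = n := by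
  obtain ⟨l, h1, h2, h3⟩ := exists_list n τ hτ (by omega)
  have hle : lenB n τ ≤ l.length := Nat.sInf_le ⟨l, rfl, h2, h3⟩
  obtain ⟨l', h4, h5, h6⟩ := Nat.sInf_mem (s := {k : ℕ | ∃ l : List (Equiv.Perm ℤ),
    l.length = k ∧ (∀ g ∈ l, g ∈ genB n) ∧ l.prod = τ}) ⟨_, l, rfl, h2, h3⟩
  have := le_of_list l' h5
  rw [h6] at this
  have h7 : l'.length = lenB n τ := h4
  omega

end NCBProof

namespace NCBProof

variable {n : ℕ} {γ τ τ' : Equiv.Perm ℤ}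

/-- Decomposition property. -/
def DecB (n : ℕ) (γ τ : Equiv.Perm ℤ) : Prop :=
  ∀ x ∈ signedSet n, ∃ u ∈ VB n, ∃ v ∈ VB n, (∀ z, u (τ z) = u z) ∧ (∀ z, v (γ z) = v (τ z)) ∧
    ∀ z, u z - v z = EB x z

lemma comp_mem {f : ℤ → ℚ} (hf : f ∈ VB n) (hτ : inB n τ) : (fun z => f (τ z)) ∈ VB n := by
  constructor
  · intro x; simp only; rw [hτ.1, hf.1]
  · intro x hx; simp only; rw [hτ.2 x hx, hf.2 x hx]

def PhiB (n : ℕ) (γ τ : Equiv.Perm ℤ) (hτ : inB n τ) :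
    (FixB n τ × FixB n (τ⁻¹ * γ)) →ₗ[ℚ] VB n where
  toFun a := ⟨fun z => a.1.1.1 z - a.2.1.1 (τ⁻¹ z),
    Submodule.sub_mem _ a.1.1.2 (comp_mem a.2.1.2 (inB_inv hτ))⟩
  map_add' a b := by
    apply Subtype.ext; funext z
    simp; ring
  map_smul' a b := by
    apply Subtype.ext; funext z
    simp; ring

lemma PhiB_inj (hτ : inB n τ) (h0 : FixB n γ = ⊥) :
    Function.Injective (PhiB n γ τ hτ) := by
  rintro ⟨u, w⟩ ⟨u', w'⟩ h
  have h1 : ∀ z, u.1.1 z - u'.1.1 z = w.1.1 (τ⁻¹ z) - w'.1.1 (τ⁻¹ z) := by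
    intro z
    have := congrFun (congrArg Subtype.val h) z
    change u.1.1 z - w.1.1 (τ⁻¹ z) = u'.1.1 z - w'.1.1 (τ⁻¹ z) at this
    linarith
  have h2 : ∀ z, w.1.1 z - w'.1.1 z = u.1.1 z - u'.1.1 z := by
    intro z
    have := h1 (τ z)
    rw [show τ⁻¹ (τ z) = z from τ.symm_apply_apply _, u.2 z, u'.2 z] at this
    exact this.symm
  have h3 : u.1 - u'.1 ∈ FixB n γ := by
    intro z
    change u.1.1 (γ z) - u'.1.1 (γ z) = u.1.1 z - u'.1.1 z
    have e1 := w.2 z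
    have e2 := w'.2 z
    rw [Equiv.Perm.mul_apply] at e1 e2
    rw [h1, e1, e2, h2]
  rw [h0, Submodule.mem_bot] at h3
  have h4 : ∀ z, u.1.1 z - u'.1.1 z = 0 := fun z => congrFun (congrArg Subtype.val h3) z
  have e1 : u = u' := by
    apply Subtype.ext; apply Subtype.ext; funext z; linarith [h4 z]
  have e2 : w = w' := by
    apply Subtype.ext; apply Subtype.ext; funext z; linarith [h4 z, h2 z]
  rw [e1, e2]

lemma EB_span {f : ℤ → ℚ} (hf : f ∈ VB n) :
    f = ∑ i : Fin n, f ((i : ℤ) + 1) • EB ((i : ℤ) + 1) := by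
  apply VB_ext hf
  · apply Submodule.sum_mem
    intro i _
    apply Submodule.smul_mem
    apply EB_mem
    rw [mem_ss, abs_le]
    omega
  · intro j
    rw [Finset.sum_apply, Finset.sum_eq_single j]
    · simp only [Pi.smul_apply, smul_eq_mul, EB]
      rw [if_pos trivial, if_neg (by omega)]; simp
    · intro i _ hij
      simp only [Pi.smul_apply, smul_eq_mul, EB]
      rw [if_neg, if_neg (by omega)]; · simp
      intro h; apply hij; ext; omega
    · simp

instance : Module.Free ℚ (FixB n τ) := Module.Free.of_divisionRing ℚ (FixB n τ)
instance : Module.Finite ℚ (FixB n τ) := FiniteDimensional.finiteDimensional_submodule (FixB n τ)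

theorem leB_iff (hγ : inB n γ) (h0 : FixB n γ = ⊥) (hτ : inB n τ) : leB n τ γ ↔ DecB n γ τ := by
  have l1 := lenB_add hγ
  have l2 := lenB_add hτ
  have l3 := lenB_add (inB_mul (inB_inv hτ) hγ)
  rw [h0, finrank_bot] at l1
  have inj := PhiB_inj hτ h0
  have step1 : leB n τ γ ↔ Module.finrank ℚ (FixB n τ × FixB n (τ⁻¹ * γ)) = Module.finrank ℚ (VB n) := by
    rw [Module.finrank_prod, finrank_VB]
    unfold leB
    omega
  rw [step1]
  constructor
  · intro he
    have surj := (LinearMap.injective_iff_surjective_of_finrank_eq_finrank (K := ℚ) (V := FixB n τ × FixB n (τ⁻¹ * γ)) (V₂ := VB n) he (f := PhiB n γ τ hτ)).mp inj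
    intro x hx
    obtain ⟨⟨u, w⟩, huw⟩ := surj ⟨EB x, EB_mem hx⟩
    refine ⟨u.1.1, u.1.2, fun z => w.1.1 (τ⁻¹ z), comp_mem w.1.2 (inB_inv hτ), u.2, ?_, ?_⟩
    · intro z
      change w.1.1 (τ⁻¹ (γ z)) = w.1.1 (τ⁻¹ (τ z))
      rw [show τ⁻¹ (τ z) = z from τ.symm_apply_apply _]
      exact w.2 z
    · intro z
      exact congrFun (congrArg Subtype.val huw) z
  · intro hD
    have hE : ∀ x (hx : x ∈ signedSet n), (⟨EB x, EB_mem hx⟩ : VB n) ∈ LinearMap.range (PhiB n γ τ hτ) := by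
      intro x hx
      obtain ⟨u, hu, v, hv, h1, h2, h3⟩ := hD x hx
      refine ⟨⟨⟨⟨u, hu⟩, h1⟩, ⟨⟨fun z => v (τ z), comp_mem hv hτ⟩, ?_⟩⟩, ?_⟩
      · intro z
        change v (τ (τ⁻¹ (γ z))) = v (τ z)
        rw [show τ (τ⁻¹ (γ z)) = γ z from τ.apply_symm_apply _]
        exact h2 z
      · apply Subtype.ext
        funext z
        change u z - v (τ (τ⁻¹ z)) = EB x z
        rw [show τ (τ⁻¹ z) = z from τ.apply_symm_apply _, h3]
    have surj : Function.Surjective (PhiB n γ τ hτ) := by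
      rw [← LinearMap.range_eq_top, eq_top_iff]
      intro f _
      have hs : ∀ i : Fin n, ((i : ℤ) + 1) ∈ signedSet n := by
        intro i; rw [mem_ss, abs_le]; omega
      have : f = ∑ i : Fin n, f.1 ((i : ℤ) + 1) • (⟨EB ((i : ℤ) + 1), EB_mem (hs i)⟩ : VB n) := by
        apply Subtype.ext
        conv_lhs => rw [EB_span f.2]
        simp
      rw [this]
      exact Submodule.sum_mem _ fun i _ => Submodule.smul_mem _ _ (hE _ (hs i))
    exact LinearEquiv.finrank_eq (LinearEquiv.ofBijective _ ⟨inj, surj⟩)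

lemma sum_comp' (hτ : inB n τ) (f : ℤ → ℚ) :
    ∑ x ∈ Finset.Icc (-(n : ℤ)) n, f (τ x) = ∑ x ∈ Finset.Icc (-(n : ℤ)) n, f x := by
  apply Equiv.Perm.sum_comp
  intro a ha
  by_contra hn
  apply ha
  apply hτ.2
  intro h
  apply hn
  rw [mem_ss, abs_le] at h
  simp [h.2]

lemma orth (hτ : inB n τ) (f g : ℤ → ℚ) (hg : ∀ z, g (τ z) = g z) :
    ∑ x ∈ Finset.Icc (-(n : ℤ)) n, (f (τ x) - f x) * g x = 0 := by
  have := sum_comp' hτ (fun z => f z * g z)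
  simp only [hg] at this
  simp only [sub_mul, Finset.sum_sub_distrib, this, sub_self]

theorem dec_inj (hγ : inB n γ) (h0 : FixB n γ = ⊥) (hτ : inB n τ) (hτ' : inB n τ')
    (hD : DecB n γ τ) (hD' : DecB n γ τ') (hF : FixB n τ = FixB n τ') : τ = τ' := by
  have key : ∀ x ∈ signedSet n, ∀ z, EB x (τ z) = EB x (τ' z) := by
    intro x hx
    obtain ⟨u1, hu1, v1, hv1, a1, b1, c1⟩ := hD x hx
    obtain ⟨u2, hu2, v2, hv2, a2, b2, c2⟩ := hD' x hx
    have m1 : (⟨u1, hu1⟩ : VB n) ∈ FixB n τ := a1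
    have m2 : (⟨u2, hu2⟩ : VB n) ∈ FixB n τ' := a2
    have m1' : (⟨u1, hu1⟩ : VB n) ∈ FixB n τ' := hF ▸ m1
    have m2' : (⟨u2, hu2⟩ : VB n) ∈ FixB n τ := hF ▸ m2
    have a1' : ∀ z, u1 (τ' z) = u1 z := m1'
    have a2' : ∀ z, u2 (τ z) = u2 z := m2'
    have huv : ∀ z, u1 z - u2 z = v1 z - v2 z := by intro z; linarith [c1 z, c2 z]
    set u : ℤ → ℚ := fun z => u1 z - u2 z with hu
    have hγu : ∀ z, u (γ z) - u z = (v1 (τ z) - v1 z) - (v2 (τ' z) - v2 z) := by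
      intro z
      simp only [hu]
      rw [huv, huv, b1, b2]; ring
    have s1 := orth hτ v1 u (by intro z; simp only [hu, a1, a2'])
    have s2 := orth hτ' v2 u (by intro z; simp only [hu, a1', a2])
    have s3 : ∑ x ∈ Finset.Icc (-(n : ℤ)) n, (u (γ x) - u x) * u x = 0 := by
      simp only [hγu, sub_mul _ _ (u _), Finset.sum_sub_distrib] at *
      linarith
    have s4 := sum_comp' hγ (fun z => u z * u z)
    have s5 : ∑ x ∈ Finset.Icc (-(n : ℤ)) n, (u (γ x) - u x) * (u (γ x) - u x) = 0 := by
      have : ∀ x, (u (γ x) - u x) * (u (γ x) - u x) =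
        (u (γ x) * u (γ x) - u x * u x) - 2 * ((u (γ x) - u x) * u x) := by intro x; ring
      simp only [this, Finset.sum_sub_distrib, ← Finset.mul_sum, s3]
      rw [s4]; simp
    rw [Finset.sum_eq_zero_iff_of_nonneg (fun i _ => mul_self_nonneg _)] at s5
    have huV : u ∈ VB n := Submodule.sub_mem _ hu1 hu2
    have hfix : (⟨u, huV⟩ : VB n) ∈ FixB n γ := by
      intro z
      change u (γ z) = u z
      by_cases hz : z ∈ signedSet n
      · have := s5 z (by rw [mem_ss, abs_le] at hz; simp [hz.2])
        have := mul_self_eq_zero.mp this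
        linarith
      · rw [hγ.2 z hz]
    rw [h0, Submodule.mem_bot] at hfix
    have hu0 : ∀ z, u z = 0 := fun z => congrFun (congrArg Subtype.val hfix) z
    intro z
    rw [← c1, ← c2, a1, a2, ← b1, ← b2]
    have e1 := hu0 z
    have e2 := hu0 (γ z)
    have e3 := huv (γ z)
    simp only [hu] at e1 e2
    linarith
  ext z
  by_cases hz : z ∈ signedSet n
  · have h1 := inB_mem hτ hz
    have := key _ h1 z
    rw [(EB_one h1).mpr rfl] at this
    exact ((EB_one h1).mp this.symm).symm
  · rw [hτ.2 z hz, hτ'.2 z hz]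

end NCBProof

namespace NCBProof

def rr (p q : ℕ) (b : Bool) : ℤ := if b then q else p
def offs (p : ℕ) (b : Bool) : ℤ := if b then p else 0
def oo (p q : ℕ) (b : Bool) (i : ℤ) : ℤ :=
  if Even (i / rr p q b) then offs p b + i % rr p q b + 1 else -(offs p b + i % rr p q b + 1)

variable {p q : ℕ}

lemma rr_pos (hp : 1 ≤ p) (hq : 1 ≤ q) (b : Bool) : 0 < rr p q b := by
  unfold rr; split_ifs <;> omega

lemma oo_add (hp : 1 ≤ p) (hq : 1 ≤ q) (b : Bool) (i : ℤ) :
    oo p q b (i + rr p q b) = - oo p q b i := by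
  have hr := rr_pos hp hq b
  unfold oo
  rw [Int.add_ediv_of_dvd_right (dvd_refl _), Int.ediv_self hr.ne', Int.add_emod_right]
  have := @Int.even_add_one (i / rr p q b)
  by_cases h : Even (i / rr p q b)
  · rw [if_neg (by rw [this]; simpa using h), if_pos h]
  · rw [if_pos (by rw [this]; exact h), if_neg h]; ring

lemma oo_mul (hp : 1 ≤ p) (hq : 1 ≤ q) (b : Bool) (i m : ℤ) :
    oo p q b (i + 2 * rr p q b * m) = oo p q b i := by
  have key : ∀ i, oo p q b (i + 2 * rr p q b) = oo p q b i := by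
    intro i
    rw [show i + 2 * rr p q b = i + rr p q b + rr p q b by ring, oo_add hp hq, oo_add hp hq, neg_neg]
  induction m using Int.induction_on with
  | zero => simp
  | succ j ih => rw [← ih, ← key (i + 2 * rr p q b * j)]; congr 1; ring
  | pred j ih => rw [← ih, ← key (i + 2 * rr p q b * (-j - 1))]; congr 1; ring

lemma oo_abs (hp : 1 ≤ p) (hq : 1 ≤ q) (b : Bool) (i : ℤ) :
    |oo p q b i| = offs p b + i % rr p q b + 1 := by
  have hr := rr_pos hp hq b
  have h1 := Int.emod_nonneg i hr.ne'
  have h2 : 0 ≤ offs p b := by unfold offs; split_ifs <;> omega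
  unfold oo
  split_ifs
  · exact abs_of_nonneg (by omega)
  · rw [abs_neg]; exact abs_of_nonneg (by omega)

lemma oo_eq_iff (hp : 1 ≤ p) (hq : 1 ≤ q) {b b' : Bool} {i j : ℤ} :
    oo p q b i = oo p q b' j ↔ b = b' ∧ ∃ m, j = i + 2 * rr p q b * m := by
  constructor
  · intro h
    have ha := congrArg abs h
    rw [oo_abs hp hq, oo_abs hp hq] at ha
    have h1 := Int.emod_nonneg i (rr_pos hp hq b).ne'
    have h2 := Int.emod_lt_of_pos i (rr_pos hp hq b)
    have h3 := Int.emod_nonneg j (rr_pos hp hq b').ne'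
    have h4 := Int.emod_lt_of_pos j (rr_pos hp hq b')
    have hb : b = b' := by
      cases b <;> cases b' <;> simp [rr, offs] at * <;> omega
    subst hb
    refine ⟨rfl, ?_⟩
    have hm : i % rr p q b = j % rr p q b := by omega
    have h5 := Int.mul_ediv_add_emod i (rr p q b)
    have h6 := Int.mul_ediv_add_emod j (rr p q b)
    have hpar : Even (i / rr p q b) ↔ Even (j / rr p q b) := by
      unfold oo at h
      rw [hm] at h
      have : 0 ≤ offs p b := by unfold offs; split_ifs <;> omega
      split_ifs at h with e1 e2 e2 <;> first | omega | simp [e1, e2]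
    have hpar2 : Even (j / rr p q b - i / rr p q b) := by grind
    obtain ⟨m, hm2⟩ := hpar2
    refine ⟨m, ?_⟩
    have : j / rr p q b = i / rr p q b + 2 * m := by omega
    rw [this] at h6
    linarith
  · rintro ⟨rfl, m, rfl⟩
    rw [oo_mul hp hq]

lemma oo_surj (hp : 1 ≤ p) (hq : 1 ≤ q) {x : ℤ} (hx : x ∈ signedSet (p + q)) :
    ∃ b i, oo p q b i = x := by
  have pos : ∀ x : ℤ, 1 ≤ x → x ≤ p + q → ∃ b i, oo p q b i = x := by
    intro x h1 h2
    by_cases h : x ≤ p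
    · refine ⟨false, x - 1, ?_⟩
      simp only [oo, rr, offs, Bool.false_eq_true, if_false]
      rw [Int.ediv_eq_zero_of_lt (by omega) (by omega), Int.emod_eq_of_lt (by omega) (by omega)]
      simp
    · refine ⟨true, x - p - 1, ?_⟩
      simp only [oo, rr, offs, if_true]
      rw [Int.ediv_eq_zero_of_lt (by omega) (by omega), Int.emod_eq_of_lt (by omega) (by omega)]
      simp only [Even.zero, if_true]
      ring
  rw [mem_ss, abs_le] at hx
  push_cast at hx
  rcases lt_or_gt_of_ne hx.1 with h | h
  · obtain ⟨b, i, h1⟩ := pos (-x) (by omega) (by omega)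
    exact ⟨b, i + rr p q b, by rw [oo_add hp hq, h1, neg_neg]⟩
  · exact pos x (by omega) (by omega)

lemma oo_mem (hp : 1 ≤ p) (hq : 1 ≤ q) (b : Bool) (i : ℤ) : oo p q b i ∈ signedSet (p + q) := by
  have ha := oo_abs hp hq b i
  have h1 := Int.emod_nonneg i (rr_pos hp hq b).ne'
  have h2 := Int.emod_lt_of_pos i (rr_pos hp hq b)
  rw [mem_ss]
  have h0 : 0 ≤ offs p b := by unfold offs; split_ifs <;> omega
  refine ⟨fun h => ?_, ?_⟩
  · rw [h, abs_zero] at ha; omega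
  · rw [ha]; push_cast
    cases b <;> simp [rr, offs] at * <;> omega

lemma oo_mem_p (hp : 1 ≤ p) (hq : 1 ≤ q) (b : Bool) (i : ℤ) :
    oo p q b i ∈ signedSet p ↔ b = false := by
  have ha := oo_abs hp hq b i
  have h3 := (oo_mem hp hq b i).1
  have h1 := Int.emod_nonneg i (rr_pos hp hq b).ne'
  have h2 := Int.emod_lt_of_pos i (rr_pos hp hq b)
  rw [mem_ss, ha]
  cases b <;> simp [rr, offs] at *
  · exact ⟨h3, by omega⟩
  · intro _; omega

lemma oo_mem_q (hp : 1 ≤ p) (hq : 1 ≤ q) (b : Bool) (i : ℤ) :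
    oo p q b i ∈ innerSet p q ↔ b = true := by
  have ha := oo_abs hp hq b i
  have h1 := Int.emod_nonneg i (rr_pos hp hq b).ne'
  have h2 := Int.emod_lt_of_pos i (rr_pos hp hq b)
  change ((p : ℤ) < |oo p q b i| ∧ |oo p q b i| ≤ (p : ℤ) + (q : ℤ)) ↔ _
  rw [ha]
  cases b <;> simp [rr, offs] at * <;> omega

lemma cyc (L : List ℤ) (R : ℕ) (f : ℤ → ℤ) (hR : 0 < R) (hlen : L.length = R)
    (hget : ∀ (i : ℕ) (h : i < L.length), L[i] = f i) (hper : ∀ i m, f (i + R * m) = f i)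
    (hinj : ∀ i j : ℕ, i < R → j < R → f i = f j → i = j) (i : ℤ) :
    L.formPerm (f i) = f (i + 1) := by
  have hnd : L.Nodup := by
    rw [List.nodup_iff_injective_get]
    intro a b hab
    have ha := a.2
    have hb := b.2
    simp only [List.get_eq_getElem, hget] at hab
    exact Fin.ext (hinj _ _ (by omega) (by omega) hab)
  have hmod : ∀ i : ℤ, f i = f (i % R) := by
    intro i
    conv_lhs => rw [← Int.emod_add_mul_ediv i R]
    exact hper _ _
  have h1 := Int.emod_nonneg i (by omega : (R : ℤ) ≠ 0)
  have h2 := Int.emod_lt_of_pos i (by omega : 0 < (R : ℤ))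
  have h3 : (i % R).toNat < L.length := by omega
  have h4 := List.formPerm_apply_getElem L hnd (i % R).toNat h3
  rw [hget, hget, hlen] at h4
  rw [hmod i, hmod (i + 1)]
  rw [Int.toNat_of_nonneg h1] at h4
  rw [h4]
  congr 1
  push_cast
  rw [Int.toNat_of_nonneg h1]
  simp

lemma oo_small (hp : 1 ≤ p) (hq : 1 ≤ q) (b : Bool) (i : ℤ) (h0 : 0 ≤ i) (h : i < rr p q b) :
    oo p q b i = offs p b + i + 1 := by
  unfold oo
  rw [Int.ediv_eq_zero_of_lt h0 h, Int.emod_eq_of_lt h0 h]; simp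

lemma list_get (f : ℕ → ℤ) (R i : ℕ) (h : i < (((List.range R).map f) ++ ((List.range R).map fun i => -(f i))).length) :
    (((List.range R).map f) ++ ((List.range R).map fun i => -(f i)))[i] =
      if i < R then f i else - f (i - R) := by
  rw [List.getElem_append]
  simp only [List.length_map, List.length_range, List.getElem_map, List.getElem_range]
  split_ifs <;> rfl

def Lb (p q : ℕ) (b : Bool) : List ℤ :=
  if b then (((List.range q).map fun i : ℕ => ((p : ℤ) + (i : ℤ) + 1)) ++
      ((List.range q).map fun i : ℕ => -((p : ℤ) + (i : ℤ) + 1)))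
  else (((List.range p).map fun i : ℕ => ((i : ℤ) + 1)) ++
      ((List.range p).map fun i : ℕ => -((i : ℤ) + 1)))

lemma Lb_get (hp : 1 ≤ p) (hq : 1 ≤ q) (b : Bool) (i : ℕ) (h : i < (Lb p q b).length) :
    (Lb p q b)[i] = oo p q b i := by
  have aux : ∀ (b : Bool) (R : ℕ) (i : ℕ), rr p q b = R → i < 2 * R → 
    (if i < R then offs p b + i + 1 else - (offs p b + ((i - R : ℕ) : ℤ) + 1)) = oo p q b i := by
    intro b R i hR hi
    split_ifs with hlt
    · rw [oo_small hp hq b i (by omega) (by omega)]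
    · have := oo_add hp hq b (i - R)
      rw [oo_small hp hq b (i - R) (by omega) (by omega), hR, sub_add_cancel] at this
      rw [this]
      push_cast [not_lt.mp hlt]
      ring
  cases b
  · rw [← aux false p i rfl (by simpa [Lb, two_mul] using h)]
    refine (list_get (fun i : ℕ => ((i : ℤ) + 1)) p i h).trans ?_
    simp [offs]
  · rw [← aux true q i rfl (by simpa [Lb, two_mul] using h)]
    refine (list_get (fun i : ℕ => ((p : ℤ) + (i : ℤ) + 1)) q i h).trans ?_
    simp [offs]

lemma Lb_len (b : Bool) : ((Lb p q b).length : ℤ) = 2 * rr p q b := by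
  cases b <;> simp [Lb, rr] <;> ring

lemma Lb_cyc (hp : 1 ≤ p) (hq : 1 ≤ q) (b : Bool) (i : ℤ) :
    (Lb p q b).formPerm (oo p q b i) = oo p q b (i + 1) := by
  have hl := Lb_len (p := p) (q := q) b
  have hr := rr_pos hp hq b
  apply cyc _ (Lb p q b).length _ (by omega) rfl (Lb_get hp hq b)
  · intro i m; rw [hl, oo_mul hp hq]
  · intro i j hi hj h
    obtain ⟨-, m, hm⟩ := (oo_eq_iff hp hq).mp h
    have : m = 0 := by
      rcases lt_trichotomy m 0 with h0 | h0 | h0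
      · nlinarith
      · exact h0
      · nlinarith
    subst this
    omega

lemma Lb_mem (hp : 1 ≤ p) (hq : 1 ≤ q) {b : Bool} {x : ℤ} (h : x ∈ Lb p q b) : ∃ i, x = oo p q b i := by
  obtain ⟨i, hi, rfl⟩ := List.getElem_of_mem h
  exact ⟨i, Lb_get hp hq b i hi⟩

lemma gamma_eq : gammaPQ p q = (Lb p q false).formPerm * (Lb p q true).formPerm := by
  have key : ∀ (m : ℕ) (f : ℤ → ℤ), (do let a ← List.range m; pure (a : ℤ) : List ℤ).map f =
      (List.range m).map fun i : ℕ => f (i : ℤ) := by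
    intro m f
    rw [List.bind_eq_flatMap, List.map_flatMap, List.map_eq_flatMap]
    rfl
  unfold gammaPQ
  simp only [Lb, if_true, Bool.false_eq_true, if_false]
  rw [key, key, key, key]

lemma gamma_oo (hp : 1 ≤ p) (hq : 1 ≤ q) (b : Bool) (i : ℤ) :
    gammaPQ p q (oo p q b i) = oo p q b (i + 1) := by
  rw [gamma_eq, Equiv.Perm.mul_apply]
  have hne : ∀ b i, oo p q b i ∉ Lb p q (!b) := by
    intro b i h
    obtain ⟨j, hj⟩ := Lb_mem hp hq h
    have := ((oo_eq_iff hp hq).mp hj).1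
    cases b <;> simp at this
  cases b
  · rw [List.formPerm_apply_of_notMem (show oo p q false i ∉ Lb p q true from hne false i), Lb_cyc hp hq]
  · rw [Lb_cyc hp hq, List.formPerm_apply_of_notMem (show oo p q true (i + 1) ∉ Lb p q false from hne true (i + 1))]

lemma gamma_out (hp : 1 ≤ p) (hq : 1 ≤ q) {x : ℤ} (hx : x ∉ signedSet (p + q)) :
    gammaPQ p q x = x := by
  have hne : ∀ b, x ∉ Lb p q b := by
    intro b h
    obtain ⟨j, rfl⟩ := Lb_mem hp hq h
    exact hx (oo_mem hp hq _ _)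
  rw [gamma_eq, Equiv.Perm.mul_apply, List.formPerm_apply_of_notMem (hne _),
    List.formPerm_apply_of_notMem (hne _)]

lemma gamma_inB (hp : 1 ≤ p) (hq : 1 ≤ q) : inB (p + q) (gammaPQ p q) := by
  refine ⟨?_, fun x hx => gamma_out hp hq hx⟩
  intro x
  by_cases hx : x ∈ signedSet (p + q)
  · obtain ⟨b, i, rfl⟩ := oo_surj hp hq hx
    rw [← oo_add hp hq, gamma_oo hp hq, gamma_oo hp hq, ← oo_add hp hq]
    congr 1; ring
  · rw [gamma_out hp hq hx, gamma_out hp hq (by rwa [neg_ss])]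

lemma gamma_fix (hp : 1 ≤ p) (hq : 1 ≤ q) : FixB (p + q) (gammaPQ p q) = ⊥ := by
  rw [eq_bot_iff]
  intro f hf
  rw [Submodule.mem_bot]
  apply Subtype.ext
  funext x
  change f.1 x = 0
  by_cases hx : x ∈ signedSet (p + q)
  · obtain ⟨b, i, rfl⟩ := oo_surj hp hq hx
    have key : ∀ n : ℕ, f.1 (oo p q b (i + n)) = f.1 (oo p q b i) := by
      intro n
      induction n with
      | zero => simp
      | succ n ih =>
        rw [← ih, ← hf (oo p q b (i + n)), gamma_oo hp hq]
        push_cast; rw [add_assoc]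
    have h1 := key (rr p q b).toNat
    rw [Int.toNat_of_nonneg (rr_pos hp hq b).le, oo_add hp hq, f.2.1] at h1
    linarith
  · exact f.2.2 x hx

end NCBProof

namespace NCBProof
variable {p q : ℕ}

lemma lift_fun (hp : 1 ≤ p) (hq : 1 ≤ q) (Q : Bool → ℤ → ℚ)
    (hQ : ∀ b j, Q b (j + rr p q b) = - Q b j) :
    ∃ u ∈ VB (p + q), ∀ b j, u (oo p q b j) = Q b j := by
  classical
  have h2 : ∀ b j m, Q b (j + 2 * rr p q b * m) = Q b j := by
    intro b j m
    have key : ∀ i, Q b (i + 2 * rr p q b) = Q b i := by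
      intro i
      rw [show i + 2 * rr p q b = i + rr p q b + rr p q b by ring, hQ, hQ, neg_neg]
    induction m using Int.induction_on with
    | zero => simp
    | succ i ih => rw [← ih, ← key (j + 2 * rr p q b * i)]; congr 1; ring
    | pred i ih => rw [← ih, ← key (j + 2 * rr p q b * (-i - 1))]; congr 1; ring
  have hch : ∀ x : ℤ, ∃ y : ℚ, (x ∈ signedSet (p + q) → ∀ b j, oo p q b j = x → Q b j = y) ∧
      (x ∉ signedSet (p + q) → y = 0) := by
    intro x
    by_cases hx : x ∈ signedSet (p + q)
    · obtain ⟨b, i, rfl⟩ := oo_surj hp hq hx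
      refine ⟨Q b i, fun _ b' j h => ?_, fun h => (h hx).elim⟩
      obtain ⟨rfl, m, rfl⟩ := (oo_eq_iff hp hq).mp h
      rw [h2]
    · exact ⟨0, fun h => (hx h).elim, fun _ => rfl⟩
  choose u hu using hch
  have hval : ∀ b j, u (oo p q b j) = Q b j := fun b j =>
    ((hu _).1 (oo_mem hp hq b j) b j rfl).symm
  refine ⟨u, ⟨?_, fun x hx => (hu x).2 hx⟩, hval⟩
  intro x
  by_cases hx : x ∈ signedSet (p + q)
  · obtain ⟨b, i, rfl⟩ := oo_surj hp hq hx
    rw [← oo_add hp hq, hval, hval, hQ]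
  · rw [(hu x).2 hx, (hu _).2 (by rwa [neg_ss])]; simp

def JT (p q : ℕ) (τ : Equiv.Perm ℤ) (b : Bool) (s : ℤ) (b' : Bool) (s' : ℤ) : Prop :=
  (Odd s ∧ Even s' ∧ τ (oo p q b (s / 2)) = oo p q b' (s' / 2)) ∨
  (Even s ∧ Odd s' ∧ τ (oo p q b' (s' / 2)) = oo p q b (s / 2))

lemma JT_odd {τ : Equiv.Perm ℤ} {b b' : Bool} {i s' : ℤ} : JT p q τ b (2 * i + 1) b' s' ↔
    ∃ j, s' = 2 * j ∧ τ (oo p q b i) = oo p q b' j := by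
  have e : (2 * i + 1) / 2 = i := by omega
  unfold JT
  rw [e]
  constructor
  · rintro (⟨-, h, h1⟩ | ⟨h, -⟩)
    · obtain ⟨j, hj⟩ := h
      refine ⟨j, by omega, ?_⟩
      rw [h1]; congr 1; omega
    · exfalso; grind
  · rintro ⟨j, rfl, h⟩
    refine Or.inl ⟨by simp, by simp, ?_⟩
    rw [h]; congr 1; omega

lemma JT_even {τ : Equiv.Perm ℤ} {b b' : Bool} {i s' : ℤ} : JT p q τ b (2 * i) b' s' ↔
    ∃ j, s' = 2 * j + 1 ∧ τ (oo p q b' j) = oo p q b i := by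
  have e : (2 * i) / 2 = i := by omega
  unfold JT
  rw [e]
  constructor
  · rintro (⟨h, -⟩ | ⟨-, h, h1⟩)
    · exfalso; grind
    · obtain ⟨j, hj⟩ := h
      refine ⟨j, by omega, ?_⟩
      rw [← h1]; congr 2; omega
  · rintro ⟨j, rfl, h⟩
    refine Or.inr ⟨by simp, by simp, ?_⟩
    rw [← h]; congr 2; omega

lemma par_cases (s : ℤ) : (∃ i, s = 2 * i + 1) ∨ ∃ i, s = 2 * i := by
  rcases Int.even_or_odd s with ⟨i, h⟩ | ⟨i, h⟩
  · exact Or.inr ⟨i, by omega⟩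
  · exact Or.inl ⟨i, h⟩

lemma JT_mat (hp : 1 ≤ p) (hq : 1 ≤ q) {τ : Equiv.Perm ℤ} (hτ : inB (p + q) τ) :
    Mat (rr p q) (JT p q τ) where
  rpos := rr_pos hp hq
  symm := by
    rintro b s b' s' (⟨h1, h2, h3⟩ | ⟨h1, h2, h3⟩)
    · exact Or.inr ⟨h2, h1, h3⟩
    · exact Or.inl ⟨h2, h1, h3⟩
  total := by
    intro b s
    rcases par_cases s with ⟨i, rfl⟩ | ⟨i, rfl⟩
    · obtain ⟨b', j, h⟩ := oo_surj hp hq (inB_mem hτ (oo_mem hp hq b i))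
      exact ⟨b', 2 * j, JT_odd.mpr ⟨j, rfl, h.symm⟩⟩
    · obtain ⟨b', j, h⟩ := oo_surj hp hq (inB_mem (inB_inv hτ) (oo_mem hp hq b i))
      exact ⟨b', 2 * j + 1, JT_even.mpr ⟨j, rfl, by rw [h]; exact τ.apply_symm_apply _⟩⟩
  func := by
    intro b s b1 s1 b2 s2 h1 h2
    rcases par_cases s with ⟨i, rfl⟩ | ⟨i, rfl⟩
    · obtain ⟨j1, rfl, e1⟩ := JT_odd.mp h1
      obtain ⟨j2, rfl, e2⟩ := JT_odd.mp h2
      rw [e1] at e2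
      obtain ⟨hb, m, hm⟩ := (oo_eq_iff hp hq).mp e2
      exact ⟨hb, m, by rw [hm]; ring⟩
    · obtain ⟨j1, rfl, e1⟩ := JT_even.mp h1
      obtain ⟨j2, rfl, e2⟩ := JT_even.mp h2
      rw [← e2] at e1
      obtain ⟨hb, m, hm⟩ := (oo_eq_iff hp hq).mp (τ.injective e1)
      exact ⟨hb, m, by rw [hm]; ring⟩
  shift := by
    intro b s b' s' h m
    rcases par_cases s with ⟨i, rfl⟩ | ⟨i, rfl⟩
    · obtain ⟨j1, rfl, e1⟩ := JT_odd.mp h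
      exact JT_odd.mpr ⟨j1 + 2 * rr p q b' * m, by ring, by rw [e1, oo_mul hp hq]⟩
    · obtain ⟨j1, rfl, e1⟩ := JT_even.mp h
      exact JT_even.mpr ⟨j1 + 2 * rr p q b' * m, by ring, by rw [← e1, oo_mul hp hq]⟩
  neg := by
    intro b s b' s' h
    rcases par_cases s with ⟨i, rfl⟩ | ⟨i, rfl⟩
    · obtain ⟨j1, rfl, e1⟩ := JT_odd.mp h
      rw [show 2 * i + 1 + 2 * rr p q b = 2 * (i + rr p q b) + 1 by ring]
      exact JT_odd.mpr ⟨j1 + rr p q b', by ring, by rw [oo_add hp hq, oo_add hp hq, hτ.1, e1]⟩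
    · obtain ⟨j1, rfl, e1⟩ := JT_even.mp h
      rw [show 2 * i + 2 * rr p q b = 2 * (i + rr p q b) by ring]
      exact JT_even.mpr ⟨j1 + rr p q b', by ring, by rw [oo_add hp hq, oo_add hp hq, hτ.1, e1]⟩
  par := by
    rintro b s b' s' (⟨h1, h2, h3⟩ | ⟨h1, h2, h3⟩) <;> grind

lemma dec_planar (hp : 1 ≤ p) (hq : 1 ≤ q) {τ : Equiv.Perm ℤ}
    (hD : DecB (p + q) (gammaPQ p q) τ) : Planar (rr p q) (JT p q τ) := by
  intro b0 s0 he
  obtain ⟨i0, rfl⟩ : ∃ i0, s0 = 2 * i0 := by obtain ⟨i, hi⟩ := he; exact ⟨i, by omega⟩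
  obtain ⟨u, hu, v, hv, h1, h2, h3⟩ := hD _ (oo_mem hp hq b0 i0)
  let P : Bool → ℤ → ℚ := fun b t => if Even t then v (oo p q b (t / 2)) else u (oo p q b (t / 2))
  have Pe : ∀ b i, P b (2 * i) = v (oo p q b i) := by
    intro b i; simp only [P]; rw [if_pos (by simp)]; congr 2; omega
  have Po : ∀ b i, P b (2 * i + 1) = u (oo p q b i) := by
    intro b i; simp only [P]; rw [if_neg (by simp)]; congr 2; omega
  refine ⟨P, ?_, ?_, ?_, ?_⟩
  · intro b t
    rcases par_cases t with ⟨i, rfl⟩ | ⟨i, rfl⟩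
    · rw [show 2 * i + 1 + 2 * rr p q b = 2 * (i + rr p q b) + 1 by ring, Po, Po, oo_add hp hq, hu.1]
    · rw [show 2 * i + 2 * rr p q b = 2 * (i + rr p q b) by ring, Pe, Pe, oo_add hp hq, hv.1]
  · intro b s b' s' hj
    rcases par_cases s with ⟨i, rfl⟩ | ⟨i, rfl⟩
    · obtain ⟨j, rfl, e⟩ := JT_odd.mp hj
      rw [Po, Po, ← e, h1]
    · obtain ⟨j, rfl, e⟩ := JT_even.mp hj
      rw [show 2 * j + 1 + 1 = 2 * (j + 1) by ring, Pe, Pe, ← gamma_oo hp hq, h2, e]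
  · rw [Pe, Po, h3]
    exact (EB_one (oo_mem hp hq b0 i0)).mpr rfl
  · intro b s hs hn
    obtain ⟨i, rfl⟩ : ∃ i0, s = 2 * i0 := by obtain ⟨i, hi⟩ := hs; exact ⟨i, by omega⟩
    rw [Pe, Po]
    have := h3 (oo p q b i)
    unfold EB at this
    rw [if_neg, if_neg] at this
    · linarith
    · intro h
      rw [← oo_add hp hq] at h
      obtain ⟨rfl, m, hm⟩ := (oo_eq_iff hp hq).mp h
      exact hn ⟨rfl, 1 - 2 * m, by linarith⟩
    · intro h
      obtain ⟨rfl, m, hm⟩ := (oo_eq_iff hp hq).mp h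
      exact hn ⟨rfl, - 2 * m, by linarith⟩

lemma pot_u (hp : 1 ≤ p) (hq : 1 ≤ q) {τ : Equiv.Perm ℤ} (hτ : inB (p + q) τ) {b0 s0 P}
    (hP : IsPot (rr p q) (JT p q τ) b0 s0 P) :
    ∃ u ∈ VB (p + q), (∀ b j, u (oo p q b j) = P b (2 * j + 1)) ∧ ∀ z, u (τ z) = u z := by
  obtain ⟨u, hu, h⟩ := lift_fun hp hq (fun b j => P b (2 * j + 1)) (by
    intro b j
    rw [show 2 * (j + rr p q b) + 1 = 2 * j + 1 + 2 * rr p q b by ring, hP.anti])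
  refine ⟨u, hu, h, ?_⟩
  intro z
  by_cases hz : z ∈ signedSet (p + q)
  · obtain ⟨b, i, rfl⟩ := oo_surj hp hq hz
    obtain ⟨b', j, e⟩ := oo_surj hp hq (inB_mem hτ hz)
    rw [← e, h, h]
    exact (hP.swap (JT_odd.mpr ⟨j, rfl, e.symm⟩)).symm
  · rw [hτ.2 z hz]

lemma planar_dec (hp : 1 ≤ p) (hq : 1 ≤ q) {τ : Equiv.Perm ℤ} (hτ : inB (p + q) τ)
    (hP : Planar (rr p q) (JT p q τ)) : DecB (p + q) (gammaPQ p q) τ := by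
  intro x hx
  obtain ⟨b0, i0, rfl⟩ := oo_surj hp hq hx
  obtain ⟨P, hP⟩ := hP b0 (2 * i0) (by simp)
  obtain ⟨u, hu, hu1, hu2⟩ := pot_u hp hq hτ hP
  obtain ⟨v, hv, hv1⟩ := lift_fun hp hq (fun b j => P b (2 * j)) (by
    intro b j
    rw [show 2 * (j + rr p q b) = 2 * j + 2 * rr p q b by ring, hP.anti])
  refine ⟨u, hu, v, hv, hu2, ?_, ?_⟩
  · intro z
    by_cases hz : z ∈ signedSet (p + q)
    · obtain ⟨b, i, rfl⟩ := oo_surj hp hq hz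
      obtain ⟨b', j, e⟩ := oo_surj hp hq (inB_mem hτ hz)
      rw [← e, gamma_oo hp hq, hv1, hv1]
      have := hP.swap (JT_even.mpr ⟨i, rfl, e.symm⟩)
      rw [this]; congr 1; ring
    · rw [hτ.2 z hz, gamma_out hp hq hz]
  · intro z
    have h0 : ∀ i, oo p q b0 i ≠ 0 := fun i => (oo_mem hp hq b0 i).1
    have base : u (oo p q b0 i0) - v (oo p q b0 i0) = 1 := by
      rw [hu1, hv1]; exact hP.jump1
    by_cases hz1 : z = oo p q b0 i0
    · rw [hz1, (EB_one hx).mpr rfl, base]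
    by_cases hz2 : z = - oo p q b0 i0
    · rw [hz2, hu.1, hv.1, (EB_mem hx).1, (EB_one hx).mpr rfl]; linarith
    by_cases hz : z ∈ signedSet (p + q)
    · obtain ⟨b, i, rfl⟩ := oo_surj hp hq hz
      unfold EB
      rw [if_neg hz1, if_neg hz2, hu1, hv1]
      rw [hP.jump0 b (2 * i) (by simp)]; · ring
      rintro ⟨rfl, m, hm⟩
      have hm' : i = i0 + rr p q b * m := by linarith
      rcases par_cases m with ⟨n, rfl⟩ | ⟨n, rfl⟩
      · apply hz2
        rw [← oo_add hp hq]
        refine (oo_eq_iff hp hq).mpr ⟨rfl, -n, by rw [hm']; ring⟩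
      · apply hz1
        refine (oo_eq_iff hp hq).mpr ⟨rfl, -n, by rw [hm']; ring⟩
    · rw [hu.2 z hz, hv.2 z hz, (EB_mem hx).2 z hz]; simp

theorem snc_iff (hp : 1 ≤ p) (hq : 1 ≤ q) {τ : Equiv.Perm ℤ} :
    τ ∈ SncB p q ↔ inB (p + q) τ ∧ Planar (rr p q) (JT p q τ) := by
  constructor
  · rintro ⟨h1, h2⟩
    exact ⟨h1, dec_planar hp hq ((leB_iff (gamma_inB hp hq) (gamma_fix hp hq) h1).mp h2)⟩
  · rintro ⟨h1, h2⟩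
    exact ⟨h1, (leB_iff (gamma_inB hp hq) (gamma_fix hp hq) h1).mpr (planar_dec hp hq h1 h2)⟩

end NCBProof

namespace NCBProof
variable {p q n : ℕ}

lemma mem_orbit {τ : Equiv.Perm ℤ} {x y : ℤ} : y ∈ permOrbit τ x ↔ ∃ m : ℤ, (τ ^ m) x = y := Iff.rfl

lemma self_orbit (τ : Equiv.Perm ℤ) (x : ℤ) : x ∈ permOrbit τ x := ⟨0, by simp⟩

lemma succ_orbit (τ : Equiv.Perm ℤ) (x : ℤ) : τ x ∈ permOrbit τ x := ⟨1, by simp⟩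

lemma orbit_eq {τ : Equiv.Perm ℤ} {x y : ℤ} (h : y ∈ permOrbit τ x) : permOrbit τ y = permOrbit τ x := by
  obtain ⟨m, rfl⟩ := h
  ext z
  constructor
  · rintro ⟨k, rfl⟩
    exact ⟨k + m, by rw [zpow_add, Equiv.Perm.mul_apply]⟩
  · rintro ⟨k, rfl⟩
    exact ⟨k - m, by rw [← Equiv.Perm.mul_apply, ← zpow_add, sub_add_cancel]⟩

lemma zpow_ind {τ : Equiv.Perm ℤ} {C : ℤ → Prop} (hC : ∀ z, C (τ z) ↔ C z) (m : ℤ) (x : ℤ) :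
    C ((τ ^ m) x) ↔ C x := by
  induction m using Int.induction_on with
  | zero => simp
  | succ i ih => rw [add_comm, zpow_add, zpow_one, Equiv.Perm.mul_apply, hC, ih]
  | pred i ih =>
    rw [← ih, ← hC ((τ ^ (-(i:ℤ) - 1)) x), ← Equiv.Perm.mul_apply, ← zpow_one_add]
    rw [show 1 + (-(i:ℤ) - 1) = -i by ring]

lemma orbit_const {τ : Equiv.Perm ℤ} {f : ℤ → ℚ} (h : ∀ z, f (τ z) = f z) {x y : ℤ}
    (hy : y ∈ permOrbit τ x) : f y = f x := by
  obtain ⟨m, rfl⟩ := hy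
  exact (zpow_ind (C := fun z => f z = f x) (fun z => by rw [h]) m x).mpr rfl

lemma fix_iff {τ : Equiv.Perm ℤ} (hτ : inB n τ) {f : ℤ → ℚ} (hf : f ∈ VB n) :
    (∀ z, f (τ z) = f z) ↔ ∀ A ∈ omegaTilde n τ, ∀ x ∈ A, ∀ y ∈ A, f x = f y := by
  constructor
  · rintro h A (⟨⟨z, hz, rfl⟩, -⟩ | ⟨rfl, -⟩) x hx y hy
    · rw [orbit_const h hx, orbit_const h hy]
    · have key : ∀ x ∈ ⋃₀ {A | A ∈ orbitsOn n τ ∧ negSet A = A}, f x = 0 := by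
        rintro x ⟨A, ⟨⟨z, hz, rfl⟩, hA⟩, hx⟩
        have h1 : -x ∈ permOrbit τ z := by
          have : x ∈ negSet (permOrbit τ z) := by rw [hA]; exact hx
          exact this
        have h2 := orbit_const h h1
        rw [hf.1, ← orbit_const h hx] at h2
        linarith
      rw [key x hx, key y hy]
  · intro h z
    by_cases hz : z ∈ signedSet n
    · by_cases hA : negSet (permOrbit τ z) = permOrbit τ z
      · apply h (⋃₀ {A | A ∈ orbitsOn n τ ∧ negSet A = A})
        · exact Or.inr ⟨rfl, z, _, ⟨⟨z, hz, rfl⟩, hA⟩, self_orbit τ z⟩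
        · exact ⟨_, ⟨⟨z, hz, rfl⟩, hA⟩, succ_orbit τ z⟩
        · exact ⟨_, ⟨⟨z, hz, rfl⟩, hA⟩, self_orbit τ z⟩
      · exact h _ (Or.inl ⟨⟨z, hz, rfl⟩, hA⟩) _ (succ_orbit τ z) _ (self_orbit τ z)
    · rw [hτ.2 z hz]

theorem omega_inj (hp : 1 ≤ p) (hq : 1 ≤ q) {τ τ' : Equiv.Perm ℤ} (h : τ ∈ SncB p q)
    (h' : τ' ∈ SncB p q) (he : omegaTilde (p + q) τ = omegaTilde (p + q) τ') : τ = τ' := by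
  have g1 := gamma_inB hp hq
  have g2 := gamma_fix hp hq
  refine dec_inj g1 g2 h.1 h'.1 ((leB_iff g1 g2 h.1).mp h.2) ((leB_iff g1 g2 h'.1).mp h'.2) ?_
  ext f
  rw [mem_Fix, mem_Fix, fix_iff h.1 f.2, fix_iff h'.1 f.2, he]

lemma Mat.eq_of_sub {r : Bool → ℤ} {J J' : Bool → ℤ → Bool → ℤ → Prop} (h : Mat r J) (h' : Mat r J')
    (hs : ∀ {b s b' s'}, J b s b' s' → J' b s b' s') {b s b' s'} : J b s b' s' ↔ J' b s b' s' := by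
  refine ⟨hs, fun hj => ?_⟩
  obtain ⟨b1, s1, h1⟩ := h.total b s
  obtain ⟨rfl, m, rfl⟩ := h'.func (hs h1) hj
  exact h.shift h1 m

lemma exists_perm (hp : 1 ≤ p) (hq : 1 ≤ q) {J : Bool → ℤ → Bool → ℤ → Prop}
    (h : Mat (rr p q) J) : ∃ τ, inB (p + q) τ ∧
      ∀ b s b' s', JT p q τ b s b' s' ↔ J b s b' s' := by
  have hch : ∀ x : ℤ, ∃ y : ℤ, (x ∉ signedSet (p + q) → y = x) ∧
      ∀ b i, oo p q b i = x → ∃ b' j, oo p q b' j = y ∧ J b (2 * i + 1) b' (2 * j) := by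
    intro x
    by_cases hx : x ∈ signedSet (p + q)
    · obtain ⟨b, i, rfl⟩ := oo_surj hp hq hx
      obtain ⟨b', s', hj⟩ := h.total b (2 * i + 1)
      have hpar := h.par hj
      obtain ⟨j, rfl⟩ : ∃ j, s' = 2 * j := by
        rcases par_cases s' with ⟨j, rfl⟩ | ⟨j, rfl⟩
        · exfalso; grind
        · exact ⟨j, rfl⟩
      refine ⟨oo p q b' j, fun hn => (hn hx).elim, ?_⟩
      intro b1 i1 e
      obtain ⟨rfl, m, rfl⟩ := (oo_eq_iff hp hq).mp e
      refine ⟨b', j, rfl, ?_⟩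
      have := h.symm (h.shift (h.symm hj) (-m))
      convert this using 1; ring
    · refine ⟨x, fun _ => rfl, ?_⟩
      rintro b i rfl
      exact (hx (oo_mem hp hq b i)).elim
  choose f hf1 hf2 using hch
  have spec : ∀ b i, ∃ b' j, f (oo p q b i) = oo p q b' j ∧ J b (2 * i + 1) b' (2 * j) := by
    intro b i
    obtain ⟨b', j, e, hj⟩ := hf2 _ b i rfl
    exact ⟨b', j, e.symm, hj⟩
  have val : ∀ {b i b' j}, J b (2 * i + 1) b' (2 * j) → f (oo p q b i) = oo p q b' j := by
    intro b i b' j hj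
    obtain ⟨b1, j1, e, hj1⟩ := spec b i
    obtain ⟨rfl, m, hm⟩ := h.func hj1 hj
    rw [e]
    exact (oo_eq_iff hp hq).mpr ⟨rfl, m, by linarith⟩
  have hJ : ∀ {b i b' j}, f (oo p q b i) = oo p q b' j → J b (2 * i + 1) b' (2 * j) := by
    intro b i b' j e
    obtain ⟨b1, j1, e1, hj1⟩ := spec b i
    rw [e1] at e
    obtain ⟨rfl, m, rfl⟩ := (oo_eq_iff hp hq).mp e
    have := h.shift hj1 m
    convert this using 1; ring
  have fmem : ∀ x, x ∈ signedSet (p + q) → f x ∈ signedSet (p + q) := by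
    intro x hx
    obtain ⟨b, i, rfl⟩ := oo_surj hp hq hx
    obtain ⟨b', j, e, -⟩ := spec b i
    rw [e]; exact oo_mem hp hq _ _
  have inj : Function.Injective f := by
    intro x x' e
    by_cases hx : x ∈ signedSet (p + q) <;> by_cases hx' : x' ∈ signedSet (p + q)
    · obtain ⟨b, i, rfl⟩ := oo_surj hp hq hx
      obtain ⟨b1, i1, rfl⟩ := oo_surj hp hq hx'
      obtain ⟨b', j, e1, hj⟩ := spec b i
      rw [e1] at e
      have hj' := hJ e.symm
      obtain ⟨rfl, m, hm⟩ := h.func (h.symm hj) (h.symm hj')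
      exact (oo_eq_iff hp hq).mpr ⟨rfl, m, by linarith⟩
    · exfalso; apply hx'; rw [← hf1 x' hx', ← e]; exact fmem x hx
    · exfalso; apply hx; rw [← hf1 x hx, e]; exact fmem x' hx'
    · rw [← hf1 x hx, ← hf1 x' hx', e]
  have surj : Function.Surjective f := by
    intro y
    by_cases hy : y ∈ signedSet (p + q)
    · obtain ⟨b, i, rfl⟩ := oo_surj hp hq hy
      obtain ⟨b', s', hj⟩ := h.total b (2 * i)
      have hpar := h.par hj
      obtain ⟨j, rfl⟩ : ∃ j, s' = 2 * j + 1 := by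
        rcases par_cases s' with ⟨j, rfl⟩ | ⟨j, rfl⟩
        · exact ⟨j, rfl⟩
        · exfalso; grind
      exact ⟨_, val (h.symm hj)⟩
    · exact ⟨y, hf1 y hy⟩
  have hin : inB (p + q) (Equiv.ofBijective f ⟨inj, surj⟩) := by
    refine ⟨?_, fun x hx => hf1 x hx⟩
    intro x
    change f (-x) = - f x
    by_cases hx : x ∈ signedSet (p + q)
    · obtain ⟨b, i, rfl⟩ := oo_surj hp hq hx
      obtain ⟨b', j, e1, hj⟩ := spec b i
      rw [e1, ← oo_add hp hq, ← oo_add hp hq]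
      apply val
      have := h.neg hj
      convert this using 1 <;> ring
    · rw [hf1 x hx, hf1 (-x) (by rwa [neg_ss])]
  refine ⟨Equiv.ofBijective f ⟨inj, surj⟩, hin, ?_⟩
  intro b s b' s'
  apply Mat.eq_of_sub (JT_mat hp hq hin) h
  intro b s b' s' hj
  rcases par_cases s with ⟨i, rfl⟩ | ⟨i, rfl⟩
  · obtain ⟨j, rfl, e⟩ := JT_odd.mp hj
    exact hJ e
  · obtain ⟨j, rfl, e⟩ := JT_even.mp hj
    exact h.symm (hJ e)

lemma perm_eq (hp : 1 ≤ p) (hq : 1 ≤ q) {τ τ' : Equiv.Perm ℤ} (h : inB (p + q) τ)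
    (h' : inB (p + q) τ') (hJ : ∀ b s b' s', JT p q τ b s b' s' → JT p q τ' b s b' s') : τ = τ' := by
  ext x
  by_cases hx : x ∈ signedSet (p + q)
  · obtain ⟨b, i, rfl⟩ := oo_surj hp hq hx
    obtain ⟨b', j, e⟩ := oo_surj hp hq (inB_mem h hx)
    obtain ⟨j', e1, e2⟩ := JT_odd.mp (hJ _ _ _ _ (JT_odd.mpr ⟨j, rfl, e.symm⟩))
    rw [← e, e2]; congr 1; omega
  · rw [h.2 x hx, h'.2 x hx]

end NCBProof

namespace NCBProof
variable {p q : ℕ}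

lemma ss_finite (n : ℕ) : (signedSet n).Finite := by
  apply (Set.finite_Icc (-(n : ℤ)) n).subset
  intro x hx
  exact abs_le.mp hx.2

lemma crossing (hp : 1 ≤ p) (hq : 1 ≤ q) {τ : Equiv.Perm ℤ} (hτ : inB (p + q) τ) {z : ℤ}
    (h1 : (permOrbit τ z ∩ signedSet p).Nonempty) (h2 : (permOrbit τ z ∩ innerSet p q).Nonempty) :
    ∃ i j, oo p q false i ∈ permOrbit τ z ∧ τ (oo p q false i) = oo p q true j := by
  by_contra hcon
  push Not at hcon
  obtain ⟨x, hx, hxp⟩ := h1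
  obtain ⟨y, hy, hyq⟩ := h2
  let T : Set ℤ := permOrbit τ z ∩ signedSet p
  have sub : ∀ w, w ∈ signedSet p → w ∈ signedSet (p + q) := by
    intro w hw
    refine ⟨hw.1, ?_⟩
    have := hw.2; push_cast; omega
  have hT : T.Finite := (ss_finite p).subset Set.inter_subset_right
  have hmap : τ '' T ⊆ T := by
    rintro _ ⟨w, ⟨hw1, hw2⟩, rfl⟩
    obtain ⟨b, i, rfl⟩ := oo_surj hp hq (sub w hw2)
    obtain rfl := (oo_mem_p hp hq b i).mp hw2
    obtain ⟨b', j, e⟩ := oo_surj hp hq (inB_mem hτ (oo_mem hp hq false i))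
    refine ⟨?_, ?_⟩
    · rw [← orbit_eq hw1]; exact succ_orbit _ _
    · rw [← e, oo_mem_p hp hq]
      cases b'
      · rfl
      · exact (hcon i j hw1 e.symm).elim
  have heq : τ '' T = T := by
    apply Set.eq_of_subset_of_ncard_le hmap _ hT
    rw [Set.ncard_image_of_injective _ τ.injective]
  have hiff : ∀ w, τ w ∈ T ↔ w ∈ T := by
    intro w
    constructor
    · intro h
      rw [← heq] at h
      obtain ⟨w', hw', e⟩ := h
      rwa [← τ.injective e]
    · intro h; exact hmap ⟨w, h, rfl⟩
  rw [← orbit_eq hx] at hy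
  obtain ⟨m, rfl⟩ := hy
  have := ((zpow_ind (C := fun w => w ∈ T) hiff m x).mpr ⟨hx, hxp⟩).2
  have h3 := this.2
  have h4 := hyq.1
  omega

section
variable {τ : Equiv.Perm ℤ} {c k : ℤ} {H : Bool → ℤ → ℤ}

lemma u_through (hp : 1 ≤ p) (hq : 1 ≤ q) (hτ : inB (p + q) τ) (W : ∀ b, Word (rr p q b) c (H b))
    (hk : Odd k) (hJ : ∀ b s b' s', JT p q τ b s b' s' ↔ RJ (rr p q) c H k b s b' s') {e : ℤ}
    (he : Even e) :
    ∃ u ∈ VB (p + q), (∀ z, u (τ z) = u z) ∧ (∀ z ∈ signedSet (p + q), u z ≠ 0) ∧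
      ∀ i, Th (H false) (2 * i + 1) →
        u (oo p q false i) = 1 / 2 * sg ((H false (2 * i + 1) - e - 1) / (2 * c)) := by
  have hJ' : JT p q τ = RJ (rr p q) c H k := by
    funext b s b' s'; exact propext (hJ b s b' s')
  obtain ⟨s0, hs, rfl⟩ := (W false).exists_level e
  have hs0 : Even s0 := by have := (W false).par s0; grind
  obtain ⟨P, hP, hP1, hP2⟩ := through_pot W hk hs0 hs
  rw [← hJ'] at hP
  obtain ⟨u, hu, hu1, hu2⟩ := pot_u hp hq hτ hP
  refine ⟨u, hu, hu2, ?_, ?_⟩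
  · intro z hz
    obtain ⟨b, i, rfl⟩ := oo_surj hp hq hz
    rw [hu1]; exact hP2 _ _
  · intro i hi
    rw [hu1, hP1, th_div (W false) hs hi]

lemma no_inv (hp : 1 ≤ p) (hq : 1 ≤ q) (hτ : inB (p + q) τ) (W : ∀ b, Word (rr p q b) c (H b))
    (hk : Odd k) (hJ : ∀ b s b' s', JT p q τ b s b' s' ↔ RJ (rr p q) c H k b s b' s') {z : ℤ}
    (hz : z ∈ signedSet (p + q)) : negSet (permOrbit τ z) ≠ permOrbit τ z := by
  intro h
  obtain ⟨u, hu, h1, h2, -⟩ := u_through hp hq hτ W hk hJ (e := 0) (by simp)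
  have h3 : -z ∈ permOrbit τ z := by
    have : z ∈ negSet (permOrbit τ z) := by rw [h]; exact self_orbit τ z
    exact this
  have h4 := orbit_const h1 h3
  rw [hu.1] at h4
  exact h2 z hz (by linarith)

lemma conn_eq (hp : 1 ≤ p) (hq : 1 ≤ q) (hτ : inB (p + q) τ) (W : ∀ b, Word (rr p q b) c (H b))
    (hk : Odd k) (hJ : ∀ b s b' s', JT p q τ b s b' s' ↔ RJ (rr p q) c H k b s b' s') :
    (connectivity p q (omegaTilde (p + q) τ) : ℤ) = c := by
  have hc : 0 < c := (W false).cpos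
  have hlev : ∀ n : ℕ, ∃ i, Th (H false) (2 * i + 1) ∧ H false (2 * i + 1) = 2 * n + 1 := by
    intro n
    obtain ⟨a, h1, h2⟩ := (W false).exists_level (2 * n + 1)
    have := (W false).par a
    rw [h2] at this
    obtain ⟨i, rfl⟩ : ∃ i, a = 2 * i + 1 := by
      rcases par_cases a with h | ⟨i, rfl⟩
      · exact h
      · exfalso; grind
    exact ⟨i, h1, h2⟩
  choose θ hθ1 hθ2 using hlev
  let g : ℕ → Set ℤ := fun n => permOrbit τ (oo p q false (θ n))
  have hset : {A | A ∈ omegaTilde (p + q) τ ∧ negSet A ≠ A ∧ (A ∩ signedSet p).Nonempty ∧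
    (A ∩ innerSet p q).Nonempty} = g '' (Set.Iio (2 * c).toNat) := by
    ext A
    constructor
    · rintro ⟨⟨⟨z, hz, rfl⟩, -⟩ | ⟨rfl, ⟨x, A, ⟨⟨z, hz, rfl⟩, hA⟩, hx⟩⟩, h1, h2, h3⟩
      · obtain ⟨i, j, hi, e⟩ := crossing hp hq hτ h2 h3
        have hr := (hJ _ _ _ _).mp (JT_odd.mpr ⟨j, rfl, e⟩)
        obtain ⟨hb, -⟩ | ⟨-, hth, -, -⟩ := hr
        · simp at hb
        set l := H false (2 * i + 1) with hl
        have hodd : Odd l := by have := (W false).par (2 * i + 1); grind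
        have e1 := Int.mul_ediv_add_emod l (4 * c)
        have e2 := Int.emod_nonneg l (by omega : 4 * c ≠ 0)
        have e3 := Int.emod_lt_of_pos l (by omega : 0 < 4 * c)
        have hodd2 : Odd (l % (4 * c)) := by
          have : Even (4 * c * (l / (4 * c))) := ⟨2 * (c * (l / (4 * c))), by ring⟩
          grind
        obtain ⟨n', hn'⟩ := hodd2
        refine ⟨n'.toNat, ?_, ?_⟩
        · simp only [Set.mem_Iio]; omega
        · rw [← orbit_eq hi]
          simp only [g]
          congr 1
          refine (oo_eq_iff hp hq).mpr ⟨rfl, l / (4 * c), ?_⟩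
          have t1 := (W false).th_shift (hθ1 n'.toNat) (2 * (l / (4 * c)))
          have t2 := (W false).per_mul (2 * (l / (4 * c))) (2 * θ n'.toNat + 1)
          have := Th.inj hth t1 (by
            rw [t2, hθ2, ← hl, Int.toNat_of_nonneg (by omega), ← hn']
            conv_lhs => rw [← e1]
            ring)
          linarith
      · exact (no_inv hp hq hτ W hk hJ hz hA).elim
    · rintro ⟨n, hn, rfl⟩
      have hz := oo_mem hp hq false (θ n)
      have hni := no_inv hp hq hτ W hk hJ hz
      refine ⟨Or.inl ⟨⟨_, hz, rfl⟩, hni⟩, hni, ⟨_, self_orbit _ _, (oo_mem_p hp hq _ _).mpr rfl⟩, ?_⟩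
      obtain ⟨a, ha1, ha2⟩ := (W true).exists_level (k - (2 * n + 1))
      have hr : RJ (rr p q) c H k false (2 * θ n + 1) true a :=
        Or.inr ⟨rfl, hθ1 n, ha1, by rw [hθ2, ha2]; simp⟩
      obtain ⟨j, rfl, e⟩ := JT_odd.mp ((hJ _ _ _ _).mpr hr)
      exact ⟨_, succ_orbit _ _, by rw [e, oo_mem_q hp hq]⟩
  have hinj : Set.InjOn g (Set.Iio (2 * c).toNat) := by
    have key : ∀ n1 n2 : ℕ, n1 < n2 → n2 < (2 * c).toNat → g n1 ≠ g n2 := by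
      intro n1 n2 h1 h2 he
      have hm : oo p q false (θ n1) ∈ permOrbit τ (oo p q false (θ n2)) := by
        have : oo p q false (θ n1) ∈ g n1 := self_orbit _ _
        rw [he] at this; exact this
      by_cases hd : 2 * ((n2 : ℤ) - n1) ≤ 2 * c
      · obtain ⟨u, -, hu, -, hv⟩ := u_through hp hq hτ W hk hJ (e := 2 * n1 + 2) ⟨n1 + 1, by ring⟩
        have h3 := orbit_const hu hm
        rw [hv _ (hθ1 n1), hv _ (hθ1 n2), hθ2, hθ2] at h3
        rw [show (2 * (n1 : ℤ) + 1 - (2 * n1 + 2) - 1) / (2 * c) = -1 by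
          rw [Int.ediv_eq_iff_of_pos (by omega)]; omega,
          show (2 * (n2 : ℤ) + 1 - (2 * n1 + 2) - 1) / (2 * c) = 0 by
          rw [Int.ediv_eq_iff_of_pos (by omega)]; omega] at h3
        norm_num [sg] at h3
      · obtain ⟨u, -, hu, -, hv⟩ := u_through hp hq hτ W hk hJ (e := 2 * n1) ⟨n1, by ring⟩
        have h3 := orbit_const hu hm
        rw [hv _ (hθ1 n1), hv _ (hθ1 n2), hθ2, hθ2] at h3
        rw [show (2 * (n1 : ℤ) + 1 - (2 * n1) - 1) / (2 * c) = 0 by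
          rw [Int.ediv_eq_iff_of_pos (by omega)]; omega,
          show (2 * (n2 : ℤ) + 1 - (2 * n1) - 1) / (2 * c) = 1 by
          rw [Int.ediv_eq_iff_of_pos (by omega)]; omega] at h3
        norm_num [sg] at h3
    intro n1 h1 n2 h2 he
    rcases lt_trichotomy n1 n2 with h | h | h
    · exact (key n1 n2 h h2 he).elim
    · exact h
    · exact (key n2 n1 h h1 he.symm).elim
  unfold connectivity
  rw [hset, Set.ncard_image_of_injOn hinj, ← Finset.coe_Iio, Set.ncard_coe_finset]
  simp
  omega
end

end NCBProof

namespace NCBProof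
variable {p q : ℕ}

def wA (R : ℤ) (A : Finset ℕ) (s : ℤ) : ℤ := if (s % (2 * R)).toNat ∈ A then 1 else -1

lemma Hgt_nat (w : ℤ → ℤ) (n : ℕ) : Hgt w n = ∑ i ∈ Finset.range n, w i := by
  induction n with
  | zero => simp [Hgt_zero]
  | succ n ih => rw [Finset.sum_range_succ, ← ih, ← Hgt_succ]; push_cast; rfl

lemma wA_small {R : ℕ} (A : Finset ℕ) {i : ℕ} (hi : i < 2 * R) :
    wA R A i = if i ∈ A then 1 else -1 := by
  unfold wA
  have : ((i : ℤ) % (2 * (R : ℤ))).toNat = i := by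
    rw [Int.emod_eq_of_lt (by omega) (by omega)]; simp
  rw [this]

lemma Hgt_wA {R : ℕ} {A : Finset ℕ} (hA : A ⊆ Finset.range (2 * R)) :
    Hgt (wA R A) (2 * R) = 2 * A.card - 2 * R := by
  have h1 := Hgt_nat (wA R A) (2 * R)
  push_cast at h1
  rw [h1]
  have h2 : ∀ i ∈ Finset.range (2 * R), wA R A i = 2 * (if i ∈ A then 1 else 0) - 1 := by
    intro i hi
    rw [wA_small A (Finset.mem_range.mp hi)]
    split_ifs <;> norm_num
  rw [Finset.sum_congr rfl h2, Finset.sum_sub_distrib, ← Finset.mul_sum, Finset.sum_boole,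
    Finset.filter_mem_eq_inter, Finset.inter_eq_right.mpr hA]
  simp

lemma wA_per (R : ℤ) (A : Finset ℕ) (t : ℤ) : wA R A (t + 2 * R) = wA R A t := by
  unfold wA; rw [Int.add_emod_right]

lemma word_wA {R c : ℕ} (hR : 1 ≤ R) (hc : 1 ≤ c) {A : Finset ℕ}
    (hA : A ∈ Finset.powersetCard (R + c) (Finset.range (2 * R))) :
    Word R c (Hgt (wA R A)) := by
  rw [Finset.mem_powersetCard] at hA
  refine ⟨by omega, by omega, ?_, ?_, Hgt_zero _⟩
  · intro t
    rw [Hgt_succ]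
    unfold wA
    split_ifs
    · left; rfl
    · right; ring
  · intro t
    rw [Hgt_per (wA_per R A), Hgt_wA hA.1, hA.2]; push_cast; ring

lemma wA_inj {R : ℕ} {A A' : Finset ℕ} (h1 : A ⊆ Finset.range (2 * R))
    (h2 : A' ⊆ Finset.range (2 * R)) (h : ∀ s, wA R A s = wA R A' s) : A = A' := by
  ext i
  by_cases hi : i < 2 * R
  · have := h i
    rw [wA_small A hi, wA_small A' hi] at this
    split_ifs at this <;> simp_all
  · constructor
    · intro hm; exact (hi (Finset.mem_range.mp (h1 hm))).elim
    · intro hm; exact (hi (Finset.mem_range.mp (h2 hm))).elim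

lemma wA_surj {R c : ℕ} {w : ℤ → ℤ} (hw : ∀ s, w s = 1 ∨ w s = -1)
    (W : Word R c (Hgt w)) :
    ∃ A ∈ Finset.powersetCard (R + c) (Finset.range (2 * R)), w = wA R A := by
  classical
  have hR := W.rpos
  have hper : ∀ t m, w (t + 2 * R * m) = w t := by
    intro t m
    have h1 := W.per_mul m t
    have h2 := W.per_mul m (t + 1)
    rw [Hgt_succ] at h2
    rw [show t + 1 + 2 * R * m = t + 2 * R * m + 1 by ring, Hgt_succ] at h2
    linarith
  let A := (Finset.range (2 * R)).filter (fun i : ℕ => w i = 1)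
  have hA : A ⊆ Finset.range (2 * R) := Finset.filter_subset _ _
  have hwA : w = wA R A := by
    funext s
    have h1 := hper (s % (2 * R)) (s / (2 * R))
    rw [Int.emod_add_mul_ediv] at h1
    have h2 := Int.emod_nonneg s (by omega : 2 * (R : ℤ) ≠ 0)
    have h3 := Int.emod_lt_of_pos s (by omega : 0 < 2 * (R : ℤ))
    unfold wA
    simp only [A, Finset.mem_filter, Finset.mem_range]
    rw [Int.toNat_of_nonneg h2, ← h1]
    have h4 : (s % (2 * (R : ℤ))).toNat < 2 * R := by omega
    rcases hw s with h | h
    · rw [if_pos ⟨h4, h⟩, h]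
    · rw [if_neg (by rw [h]; norm_num), h]
  refine ⟨A, Finset.mem_powersetCard.mpr ⟨hA, ?_⟩, hwA⟩
  have h5 := Hgt_wA hA
  rw [← hwA] at h5
  have h6 := W.per 0
  rw [zero_add, W.zero, h5] at h6
  omega

lemma RJ_congr {r : Bool → ℤ} {c k k' : ℤ} {H : Bool → ℤ → ℤ} (h : 4 * c ∣ k - k') :
    RJ r c H k = RJ r c H k' := by
  funext b s b' s'
  unfold RJ
  have : 4 * c ∣ H b s + H b' s' - k ↔ 4 * c ∣ H b s + H b' s' - k' := by
    rw [show H b s + H b' s' - k' = (H b s + H b' s' - k) + (k - k') by ring]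
    exact (dvd_add_left h).symm
  rw [this]

noncomputable def HA (p q : ℕ) (x : (Finset ℕ × Finset ℕ) × ℕ) (b : Bool) : ℤ → ℤ :=
  if b then Hgt (wA q x.1.2) else Hgt (wA p x.1.1)

noncomputable def Fx (p q c : ℕ) : Finset ((Finset ℕ × Finset ℕ) × ℕ) :=
  ((Finset.powersetCard (p + c) (Finset.range (2 * p))) ×ˢ
    (Finset.powersetCard (q + c) (Finset.range (2 * q)))) ×ˢ Finset.range (2 * c)

lemma mem_Fx {c : ℕ} {x : (Finset ℕ × Finset ℕ) × ℕ} : x ∈ Fx p q c ↔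
    x.1.1 ∈ Finset.powersetCard (p + c) (Finset.range (2 * p)) ∧
    x.1.2 ∈ Finset.powersetCard (q + c) (Finset.range (2 * q)) ∧ x.2 < 2 * c := by
  simp [Fx, and_assoc]

lemma HA_word (hp : 1 ≤ p) (hq : 1 ≤ q) {c : ℕ} (hc : 1 ≤ c) {x : (Finset ℕ × Finset ℕ) × ℕ}
    (hx : x ∈ Fx p q c) (b : Bool) : Word (rr p q b) c (HA p q x b) := by
  obtain ⟨h1, h2, -⟩ := mem_Fx.mp hx
  cases b
  · exact word_wA hp hc h1
  · exact word_wA hq hc h2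

theorem main_count (p q c : ℕ) (hp : 1 ≤ p) (hq : 1 ≤ q) (hc1 : 1 ≤ c) (hcp : c ≤ p) (hcq : c ≤ q) :
    {π | π ∈ NCB p q ∧ connectivity p q π = c}.ncard =
      2 * c * Nat.choose (2 * p) (p - c) * Nat.choose (2 * q) (q - c) := by
  have hkodd : ∀ n : ℕ, Odd (2 * (n : ℤ) + 1) := fun n => ⟨n, rfl⟩
  have hex : ∀ x : (Finset ℕ × Finset ℕ) × ℕ, ∃ τ : Equiv.Perm ℤ, x ∈ Fx p q c →
      (inB (p + q) τ ∧ ∀ b s b' s', JT p q τ b s b' s' ↔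
        RJ (rr p q) c (HA p q x) (2 * x.2 + 1) b s b' s') := by
    intro x
    by_cases hx : x ∈ Fx p q c
    · obtain ⟨τ, h⟩ := exists_perm hp hq (RJ_mat (HA_word hp hq hc1 hx) (hkodd x.2))
      exact ⟨τ, fun _ => h⟩
    · exact ⟨1, fun h => (hx h).elim⟩
  choose T hT using hex
  have hJeq : ∀ {x}, x ∈ Fx p q c → JT p q (T x) = RJ (rr p q) c (HA p q x) (2 * x.2 + 1) := by
    intro x hx
    funext b s b' s'
    exact propext ((hT x hx).2 b s b' s')
  have hsnc : ∀ {x}, x ∈ Fx p q c → T x ∈ SncB p q := by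
    intro x hx
    rw [snc_iff hp hq, hJeq hx]
    exact ⟨(hT x hx).1, RJ_planar (HA_word hp hq hc1 hx) (hkodd x.2)⟩
  have hset : {π | π ∈ NCB p q ∧ connectivity p q π = c} =
      (fun x => omegaTilde (p + q) (T x)) '' (Fx p q c : Set ((Finset ℕ × Finset ℕ) × ℕ)) := by
    ext π
    constructor
    · rintro ⟨⟨τ, hτ, rfl⟩, hconn⟩
      obtain ⟨hin, hpl⟩ := (snc_iff hp hq).mp hτ
      have hne : {A | A ∈ omegaTilde (p + q) τ ∧ negSet A ≠ A ∧ (A ∩ signedSet p).Nonempty ∧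
          (A ∩ innerSet p q).Nonempty}.Nonempty := by
        rw [Set.nonempty_iff_ne_empty]
        intro h0
        unfold connectivity at hconn
        rw [h0] at hconn
        simp at hconn
        omega
      obtain ⟨A, hA, hA1, hA2, hA3⟩ := hne
      obtain ⟨z, hz⟩ : ∃ z, A = permOrbit τ z := by
        rcases hA with ⟨⟨z, -, rfl⟩, -⟩ | ⟨rfl, -⟩
        · exact ⟨z, rfl⟩
        · exfalso
          apply hA1
          ext x
          constructor
          · rintro ⟨B, hB, hx⟩
            refine ⟨B, hB, ?_⟩
            rw [← hB.2] at hx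
            simpa [negSet] using hx
          · rintro ⟨B, hB, hx⟩
            refine ⟨B, hB, ?_⟩
            rw [← hB.2] at hx
            exact hx
      subst hz
      obtain ⟨i, j, -, e⟩ := crossing hp hq hin hA2 hA3
      obtain ⟨c', k, W, hk, hsub⟩ := exists_words (JT_mat hp hq hin) hpl (JT_odd.mpr ⟨j, rfl, e⟩)
      have hJ : ∀ b s b' s', JT p q τ b s b' s' ↔
          RJ (rr p q) c' (fun b => Hgt (wd (rr p q) (JT p q τ) b)) k b s b' s' :=
        fun b s b' s' => Mat.eq_of_sub (JT_mat hp hq hin) (RJ_mat W hk) hsub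
      have hc' : (c : ℤ) = c' := by rw [← conn_eq hp hq hin W hk hJ, hconn]
      subst hc'
      obtain ⟨A1, hA1, e1⟩ := wA_surj (R := p) (Mat.wd_cases false) (W false)
      obtain ⟨A2, hA2, e2⟩ := wA_surj (R := q) (Mat.wd_cases true) (W true)
      have f1 := Int.mul_ediv_add_emod k (4 * c)
      have f2 := Int.emod_nonneg k (by omega : 4 * (c : ℤ) ≠ 0)
      have f3 := Int.emod_lt_of_pos k (by omega : 0 < 4 * (c : ℤ))
      have hodd2 : Odd (k % (4 * c)) := by
        have : Even (4 * (c : ℤ) * (k / (4 * c))) := ⟨2 * (c * (k / (4 * c))), by ring⟩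
        grind
      obtain ⟨n, hn⟩ := hodd2
      have hx : ((A1, A2), n.toNat) ∈ Fx p q c := mem_Fx.mpr ⟨hA1, hA2, by simp only; omega⟩
      refine ⟨((A1, A2), n.toNat), hx, ?_⟩
      have hH : (fun b => Hgt (wd (rr p q) (JT p q τ) b)) = HA p q ((A1, A2), n.toNat) := by
        funext b
        cases b
        · simp only [HA]; rw [e1]; rfl
        · simp only [HA]; rw [e2]; rfl
      simp only
      congr 1
      apply perm_eq hp hq (hT _ hx).1 hin
      intro b s b' s' h
      rw [hJ, hH]
      rw [hJeq hx] at h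
      rw [RJ_congr (k' := 2 * (n.toNat : ℤ) + 1)]
      · exact h
      · rw [Int.toNat_of_nonneg (by omega)]
        exact ⟨k / (4 * c), by linarith⟩
    · rintro ⟨x, hx, rfl⟩
      refine ⟨⟨T x, hsnc hx, rfl⟩, ?_⟩
      have := conn_eq hp hq (hT x hx).1 (HA_word hp hq hc1 hx) (hkodd x.2) (hT x hx).2
      simp only
      exact_mod_cast this
  have hinj : Set.InjOn (fun x => omegaTilde (p + q) (T x))
      (Fx p q c : Set ((Finset ℕ × Finset ℕ) × ℕ)) := by
    intro x hx y hy he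
    have hx : x ∈ Fx p q c := hx
    have hy : y ∈ Fx p q c := hy
    have ht := omega_inj hp hq (hsnc hx) (hsnc hy) he
    have hJ : RJ (rr p q) c (HA p q x) (2 * x.2 + 1) = RJ (rr p q) c (HA p q y) (2 * y.2 + 1) := by
      rw [← hJeq hx, ← hJeq hy, ht]
    have Wx := HA_word hp hq hc1 hx
    have Wy := HA_word hp hq hc1 hy
    have hw : ∀ b s, HA p q x b (s + 1) - HA p q x b s = HA p q y b (s + 1) - HA p q y b s := by
      intro b s
      rw [RJ_wd Wx (hkodd x.2), RJ_wd Wy (hkodd y.2), hJ]; ring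
    obtain ⟨x1, x2, x3⟩ := mem_Fx.mp hx
    obtain ⟨y1, y2, y3⟩ := mem_Fx.mp hy
    have g1 : x.1.1 = y.1.1 := by
      apply wA_inj (Finset.mem_powersetCard.mp x1).1 (Finset.mem_powersetCard.mp y1).1
      intro s
      have := hw false s
      simp only [HA, Bool.false_eq_true, if_false, Hgt_succ] at this
      linarith
    have g2 : x.1.2 = y.1.2 := by
      apply wA_inj (Finset.mem_powersetCard.mp x2).1 (Finset.mem_powersetCard.mp y2).1
      intro s
      have := hw true s
      simp only [HA, if_true, Hgt_succ] at this
      linarith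
    have hH : HA p q x = HA p q y := by
      funext b; simp only [HA, g1, g2]
    obtain ⟨a, ha1, ha2⟩ := (Wx false).exists_level 0
    obtain ⟨a', ha1', ha2'⟩ := (Wx true).exists_level (2 * x.2 + 1)
    have hr : RJ (rr p q) c (HA p q x) (2 * x.2 + 1) false a true a' :=
      Or.inr ⟨rfl, ha1, ha1', by rw [ha2, ha2']; simp⟩
    rw [hJ, ← hH] at hr
    obtain ⟨hb, -⟩ | ⟨-, -, -, hd⟩ := hr
    · simp at hb
    rw [ha2, ha2'] at hd
    obtain ⟨m, hm⟩ := hd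
    have hm0 : m = 0 := by
      have hcc : (0 : ℤ) < 4 * c := by omega
      have u1 : 4 * (c : ℤ) * m < 4 * c * 1 := by omega
      have u2 : 4 * (c : ℤ) * (-1) < 4 * c * m := by omega
      have v1 := lt_of_mul_lt_mul_left u1 hcc.le
      have v2 := lt_of_mul_lt_mul_left u2 hcc.le
      omega
    subst hm0
    have g3 : x.2 = y.2 := by omega
    exact Prod.ext (Prod.ext g1 g2) g3
  rw [hset, Set.ncard_image_of_injOn hinj, Set.ncard_coe_finset]
  unfold Fx
  rw [Finset.card_product, Finset.card_product, Finset.card_powersetCard, Finset.card_powersetCard,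
    Finset.card_range, Finset.card_range, Finset.card_range]
  rw [← Nat.choose_symm_of_eq_add (show 2 * p = (p - c) + (p + c) by omega),
    ← Nat.choose_symm_of_eq_add (show 2 * q = (q - c) + (q + c) by omega)]
  ring

end NCBProof

/-- For `1 ≤ c ≤ min{p,q}`, the number of partitions in `NC^B(p,q)` with
connectivity equal to `c` is `2c·C(2p, p-c)·C(2q, q-c)`. -/
theorem ncb_conn_card (p q c : ℕ) (hp : 1 ≤ p) (hq : 1 ≤ q)
    (hc1 : 1 ≤ c) (hcp : c ≤ p) (hcq : c ≤ q) :
    {π | π ∈ NCB p q ∧ connectivity p q π = c}.ncard =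
      2 * c * Nat.choose (2 * p) (p - c) * Nat.choose (2 * q) (q - c) := by
  exact NCBProof.main_count p q c hp hq hc1 hcp hcq
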